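/- arXiv:0708.2961 — 2 statements merged into one kernel-verified Lean document; each statement's English description precedes it below -/
import Mathlib

section
/- Let A be a commutative Noetherian ring of Krull dimension d, and let P be a finitely generated projective A-module of rank d. Suppose s ∈ A is such that: (i) P_s is a free A_s-module; (ii) there exist p_1,…,p_d ∈ P and φ_1,…,φ_d ∈ Hom_A(P,A) with φ_i(p_j) = δ_{ij}·s; (iii) sP ⊆ p_1A + … + p_dA; (iv) the image of s in A_red is a non-zero-divisor; and (v) (0 : sA) = (0 : s²A). If the free module of rank d over R = A[X]/(X² − s²X) is cancellative, then P is cancellative. -/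
open Polynomial

/-- A module `P` over `A` is *cancellative* if `P ⊕ Aᵐ ≅ Q ⊕ Aᵐ` implies `P ≅ Q`
for every finitely generated projective `A`-module `Q` and every `m ≥ 0`. -/
def IsCancellative (A : Type) [CommRing A] (P : Type) [AddCommGroup P] [Module A P] : Prop :=
  ∀ (Q : Type) [AddCommGroup Q] [Module A Q], Module.Finite A Q → Module.Projective A Q →
    ∀ m : ℕ, Nonempty ((P × (Fin m → A)) ≃ₗ[A] (Q × (Fin m → A))) → Nonempty (P ≃ₗ[A] Q)

/-- A module has rank `n` if its localization at every prime ideal is of rank `n`. -/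
def HasRank (A : Type) [CommRing A] (P : Type) [AddCommGroup P] [Module A P] (n : ℕ) : Prop :=
  ∀ p : PrimeSpectrum A, Module.rankAtStalk P p = n

/-- For each minimal prime of `I` there is an element outside it lying in all the others. -/
lemma exists_notMem_and_forall_mem_minimalPrimes {A : Type*} [CommRing A]
    {I : Ideal A} {S : Finset (Ideal A)} (hS : ∀ q ∈ S, q ∈ I.minimalPrimes) {p : Ideal A}
    (hp : p ∈ S) : ∃ x, x ∉ p ∧ ∀ q ∈ S, q ≠ p → x ∈ q := by
  classical
  have hle : ¬ (∏ q ∈ S.erase p, q) ≤ p := by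
    intro h
    obtain ⟨q, hq, hqp⟩ := (hS p hp).1.1.prod_le.1 h
    rw [Finset.mem_erase] at hq
    exact hq.1 (le_antisymm hqp ((hS p hp).2 (hS q hq.2).1 hqp))
  obtain ⟨x, hx, hxp⟩ := SetLike.not_le_iff_exists.1 hle
  refine ⟨x, hxp, fun q hq hqp ↦ ?_⟩
  exact (Ideal.prod_le_inf.trans (Finset.inf_le (Finset.mem_erase.2 ⟨hqp, hq⟩))) hx

/-- Prime avoidance for the coset `c + aA`. -/
lemma exists_add_mul_notMem_of_minimalPrimes {A : Type*} [CommRing A] {I : Ideal A}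
    {S : Finset (Ideal A)} (hS : ∀ q ∈ S, q ∈ I.minimalPrimes) (c a : A)
    (ha : ∀ q ∈ S, a ∉ q) : ∃ b, ∀ q ∈ S, c + a * b ∉ q := by
  classical
  have hsep : ∀ p : Ideal A, ∃ x, p ∈ S → x ∉ p ∧ ∀ q ∈ S, q ≠ p → x ∈ q := fun p ↦ by
    by_cases hp : p ∈ S
    · obtain ⟨x, hx⟩ := exists_notMem_and_forall_mem_minimalPrimes hS hp
      exact ⟨x, fun _ ↦ hx⟩
    · exact ⟨0, fun h ↦ absurd h hp⟩
  choose x hx using hsep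
  refine ⟨∑ q ∈ S, if c ∈ q then x q else 0, fun p hp hmem ↦ ?_⟩
  rw [← Finset.add_sum_erase _ _ hp] at hmem
  have hrest : ∑ q ∈ S.erase p, (if c ∈ q then x q else 0) ∈ p := by
    refine sum_mem fun q hq ↦ ?_
    rw [Finset.mem_erase] at hq
    split_ifs
    · exact (hx q hq.2).2 p hp hq.1.symm
    · exact zero_mem _
  rw [mul_add, ← add_assoc, Ideal.add_mem_iff_left _ (Ideal.mul_mem_left _ _ hrest)] at hmem
  split_ifs at hmem with hc
  · rw [Ideal.add_mem_iff_right _ hc] at hmem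
    exact ((hS p hp).1.1.mem_or_mem hmem).elim (ha p hp) (hx p hp).1
  · exact hc (by simpa using hmem)

/-- Bass's stable range argument: away from `a`, the common zeros of `n` suitable elements of
the cosets `c i + aA` have height at least `n` more than the primes one starts with. -/
lemma exists_add_mul_height_le {A : Type*} [CommRing A] [IsNoetherianRing A] (a : A) {n : ℕ}
    (c : Fin n → A) (J : Ideal A) (k : ℕ)
    (hJ : ∀ p : Ideal A, p.IsPrime → J ≤ p → a ∉ p → (k : ℕ∞) ≤ p.height) :
    ∃ b : Fin n → A, ∀ p : Ideal A, p.IsPrime → J ≤ p → a ∉ p →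
      (∀ i, c i + a * b i ∈ p) → ((k + n : ℕ) : ℕ∞) ≤ p.height := by
  classical
  induction n generalizing J k with
  | zero => exact ⟨Fin.elim0, fun p hp hJp hap _ ↦ by simpa using hJ p hp hJp hap⟩
  | succ n ih =>
    let S := (J.finite_minimalPrimes_of_isNoetherianRing A).toFinset.filter (a ∉ ·)
    obtain ⟨b₀, hb₀⟩ := exists_add_mul_notMem_of_minimalPrimes (I := J) (S := S)
      (fun q hq ↦ by simp [S] at hq; exact hq.1) (c 0) a (fun q hq ↦ by simp [S] at hq; exact hq.2)
    obtain ⟨b, hb⟩ := ih (fun i ↦ c i.succ) (J ⊔ Ideal.span {c 0 + a * b₀}) (k + 1) (by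
      intro p hp hJp hap
      obtain ⟨hJp, hcp⟩ := sup_le_iff.1 hJp
      rw [Ideal.span_singleton_le_iff_mem] at hcp
      obtain ⟨q, hq, hqp⟩ := Ideal.exists_minimalPrimes_le hJp
      have := hq.1.1
      have haq : a ∉ q := fun h ↦ hap (hqp h)
      have hlt : q < p := lt_of_le_of_ne hqp fun h ↦
        hb₀ q (by simp [S, hq, haq]) (h ▸ hcp)
      have hk := hJ q hq.1.1 hq.1.2 haq
      have := Order.add_one_le_of_lt (Ideal.height_strict_mono_of_isPrime hlt)
      push_cast
      exact (add_le_add_left hk 1).trans this)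
    refine ⟨Fin.cons b₀ b, fun p hp hJp hap hcp ↦ ?_⟩
    have := hb p hp (sup_le hJp ((Ideal.span_singleton_le_iff_mem _).2 (by simpa using hcp 0))) hap
      (fun i ↦ by simpa using hcp i.succ)
    convert this using 2
    omega

open Module in
/-- A projective module of constant rank has, outside every given finite set of minimal primes
of an ideal, a simultaneous generic basis. -/
lemma exists_det_notMem_minimalPrimes {A M : Type*} [CommRing A] [AddCommGroup M] [Module A M]
    {r : ℕ} (hM : ∀ p : Ideal A, p.IsPrime → ∃ (e : Fin r → M) (ψ : Fin r → Dual A M),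
      (Matrix.of fun i j ↦ ψ i (e j)).det ∉ p)
    {I : Ideal A} {S : Finset (Ideal A)} (hS : ∀ q ∈ S, q ∈ I.minimalPrimes) :
    ∃ (e : Fin r → M) (ψ : Fin r → Dual A M),
      ∀ p ∈ S, (Matrix.of fun i j ↦ ψ i (e j)).det ∉ p := by
  classical
  have hsep : ∀ p : Ideal A, ∃ (x : A) (e : Fin r → M) (ψ : Fin r → Dual A M), p ∈ S →
      (x ∉ p ∧ ∀ q ∈ S, q ≠ p → x ∈ q) ∧ (Matrix.of fun i j ↦ ψ i (e j)).det ∉ p := fun p ↦ by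
    by_cases hp : p ∈ S
    · obtain ⟨x, hx⟩ := exists_notMem_and_forall_mem_minimalPrimes hS hp
      obtain ⟨e, ψ, h⟩ := hM p (hS p hp).1.1
      exact ⟨x, e, ψ, fun _ ↦ ⟨hx, h⟩⟩
    · exact ⟨0, 0, 0, fun h ↦ absurd h hp⟩
  choose x e ψ hx using hsep
  refine ⟨fun j ↦ ∑ q ∈ S, x q • e q j, fun i ↦ ∑ q ∈ S, x q • ψ q i, fun p hp hmem ↦ ?_⟩
  have hpp := (hS p hp).1.1
  have hz : ∀ q ∈ S, q ≠ p → Ideal.Quotient.mk p (x q) = 0 := fun q hq hqp ↦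
    Ideal.Quotient.eq_zero_iff_mem.2 ((hx q hq).1.2 p hp hqp.symm)
  have hmat : (Ideal.Quotient.mk p).mapMatrix (Matrix.of fun i j ↦
      (∑ q ∈ S, x q • ψ q i) (∑ q ∈ S, x q • e q j)) =
      (Ideal.Quotient.mk p (x p) ^ 2) •
        (Ideal.Quotient.mk p).mapMatrix (Matrix.of fun i j ↦ ψ p i (e p j)) := by
    ext i j
    simp only [RingHom.mapMatrix_apply, Matrix.map_apply, Matrix.of_apply, LinearMap.sum_apply,
      map_sum, LinearMap.smul_apply, map_smul, smul_eq_mul, map_mul, Matrix.smul_apply]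
    rw [Finset.sum_eq_single_of_mem p hp fun q hq hqp ↦ by
        simp [hz q hq hqp],
      Finset.sum_eq_single_of_mem p hp fun q hq hqp ↦ by simp [hz q hq hqp]]
    ring
  rw [← Ideal.Quotient.eq_zero_iff_mem, RingHom.map_det, hmat, Matrix.det_smul, ← RingHom.map_det,
    ← map_pow, ← map_pow, ← map_mul, Ideal.Quotient.eq_zero_iff_mem] at hmem
  exact (hpp.mem_or_mem hmem).elim
    (fun h ↦ (hx p hp).1.1 (hpp.mem_of_pow_mem _ (hpp.mem_of_pow_mem _ h))) (hx p hp).2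

open Module in
/-- Serre–Bass: modulo an ideal `J` all of whose primes have height at least `k`, a unimodular
element `(x, a)` of `M ⊕ A` can be shortened to a unimodular `x + a q` if
`k + rank M` exceeds all heights. -/
lemma exists_add_smul_unimodular {A M : Type*} [CommRing A] [IsNoetherianRing A]
    [AddCommGroup M] [Module A M] {r : ℕ}
    (hM : ∀ p : Ideal A, p.IsPrime → ∃ (e : Fin r → M) (ψ : Fin r → Dual A M),
      (Matrix.of fun i j ↦ ψ i (e j)).det ∉ p)
    (k₀ : ℕ) (hr : ∀ p : Ideal A, p.IsPrime → p.height < (k₀ + r : ℕ)) (a : A) (n k : ℕ)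
    (hk : k₀ ≤ k) (hn : k₀ + r ≤ k + n) (J : Ideal A)
    (hJ : ∀ p : Ideal A, p.IsPrime → J ≤ p → (k : ℕ∞) ≤ p.height) (x : M)
    (hx : ∀ p : Ideal A, p.IsPrime → J ≤ p → a ∈ p → ∃ ψ : Dual A M, ψ x ∉ p) :
    ∃ q : M, ∀ p : Ideal A, p.IsPrime → J ≤ p → ∃ ψ : Dual A M, ψ (x + a • q) ∉ p := by
  classical
  induction n generalizing k J with
  | zero =>
    refine ⟨0, fun p hp hJp ↦ absurd ((hJ p hp hJp).trans_lt (hr p hp)) (not_lt.2 ?_)⟩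
    exact_mod_cast (by omega : k₀ + r ≤ k)
  | succ n ih =>
    obtain ⟨e, ψ, hψ⟩ := exists_det_notMem_minimalPrimes hM (I := J)
      (S := (J.finite_minimalPrimes_of_isNoetherianRing A).toFinset) (by simp)
    set N : Matrix (Fin r) (Fin r) A := Matrix.of fun i j ↦ ψ i (e j) with hN
    obtain ⟨q₁, hq₁⟩ := ih (k + 1) (by omega) (by omega) (J ⊔ Ideal.span {N.det}) (by
      intro p hp hJp
      obtain ⟨hJp, hcp⟩ := sup_le_iff.1 hJp
      rw [Ideal.span_singleton_le_iff_mem] at hcp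
      obtain ⟨q, hq, hqp⟩ := Ideal.exists_minimalPrimes_le hJp
      have := hq.1.1
      have hlt : q < p := lt_of_le_of_ne hqp fun h ↦ hψ q (by simp [hq]) (h ▸ hcp)
      have := Order.add_one_le_of_lt (Ideal.height_strict_mono_of_isPrime hlt)
      push_cast
      exact (add_le_add_left (hJ q hq.1.1 hq.1.2) 1).trans this)
      (fun p hp hJp ↦ hx p hp (le_sup_left.trans hJp))
    let e' : Fin r → M := fun j ↦ ∑ l, N.adjugate l j • e l
    have he' : ∀ i j, ψ i (e' j) = if i = j then N.det else 0 := fun i j ↦ by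
      have := congr($(N.mul_adjugate) i j)
      simp only [Matrix.mul_apply, Matrix.smul_apply, Matrix.one_apply, smul_eq_mul, mul_ite,
        mul_one, mul_zero] at this
      simp only [e', map_sum, map_smul, smul_eq_mul, ← this]
      exact Finset.sum_congr rfl fun l _ ↦ mul_comm _ _
    obtain ⟨b, hb⟩ := exists_add_mul_height_le (a * N.det ^ 2) (fun i ↦ ψ i (x + a • q₁)) J k
      (fun p hp hJp _ ↦ hJ p hp hJp)
    refine ⟨q₁ + N.det • ∑ j, b j • e' j, fun p hp hJp ↦ ?_⟩
    by_contra! hcon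
    have hexp : x + a • (q₁ + N.det • ∑ j, b j • e' j) =
      (x + a • q₁) + (a * N.det) • ∑ j, b j • e' j := by
      rw [smul_add, add_assoc, mul_smul]
    rw [hexp] at hcon
    by_cases hap : a ∈ p
    · obtain ⟨θ, hθ⟩ := hx p hp hJp hap
      apply hθ
      have := hcon θ
      rw [← hexp, map_add, map_smul, smul_eq_mul] at this
      rwa [Ideal.add_mem_iff_left _ (Ideal.mul_mem_right _ _ hap)] at this
    by_cases htp : N.det ∈ p
    · obtain ⟨θ, hθ⟩ := hq₁ p hp (sup_le hJp ((Ideal.span_singleton_le_iff_mem _).2 htp))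
      apply hθ
      have := hcon θ
      rw [map_add, map_smul, smul_eq_mul, mul_comm a, mul_assoc] at this
      rwa [Ideal.add_mem_iff_left _ (Ideal.mul_mem_right _ _ htp)] at this
    refine absurd (hb p hp hJp (fun h ↦ (hp.mem_or_mem h).elim hap
      (fun h ↦ htp (hp.mem_of_pow_mem _ h))) fun i ↦ ?_)
      (not_le.2 ((hr p hp).trans_le (by exact_mod_cast (by omega))))
    have := hcon (ψ i)
    simp only [map_add, map_smul, map_sum, he', smul_eq_mul, mul_ite, mul_zero,
      Finset.sum_ite_eq, Finset.mem_univ, if_true] at this ⊢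
    convert this using 2
    ring

open Module in
lemma exists_dual_det_notMem {A M : Type*} [CommRing A] [AddCommGroup M] [Module A M]
    [Module.Finite A M] [Module.Projective A M] {r : ℕ} (p : PrimeSpectrum A)
    (hr : rankAtStalk M p = r) : ∃ (e : Fin r → M) (ψ : Fin r → Dual A M),
      (Matrix.of fun i j ↦ ψ i (e j)).det ∉ p.asIdeal := by
  classical
  let S := p.asIdeal.primeCompl
  let L := Localization.AtPrime p.asIdeal
  let f := LocalizedModule.mkLinearMap S M
  have : Module.FinitePresentation A M := Module.finitePresentation_of_projective A M
  have : Module.Free L (LocalizedModule S M) := Module.free_of_flat_of_isLocalRing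
  let b : Basis (Fin r) L (LocalizedModule S M) := Module.finBasisOfFinrankEq L _ hr
  have he : ∀ j, ∃ (m : M) (s : S), s • b j = f m := fun j ↦ by
    obtain ⟨⟨m, s⟩, h⟩ := IsLocalizedModule.surj S f (b j)
    exact ⟨m, s, h⟩
  choose e s he using he
  have hψ : ∀ i, ∃ (ψ : M →ₗ[A] A) (u : S), Algebra.linearMap A L ∘ₗ ψ =
      u • ((b.coord i).restrictScalars A ∘ₗ f) := fun i ↦
    Module.FinitePresentation.exists_lift_of_isLocalizedModule S (Algebra.linearMap A L) _
  choose ψ u hψ using hψ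
  refine ⟨e, ψ, fun hmem ↦ ?_⟩
  have hmat : (algebraMap A L).mapMatrix (Matrix.of fun i j ↦ ψ i (e j)) =
      Matrix.diagonal fun i ↦ algebraMap A L (u i * s i) := by
    ext i j
    have h1 : algebraMap A L (ψ i (e j)) = (u i : A) • b.coord i (f (e j)) := by
      simpa [Submonoid.smul_def] using congr($(hψ i) (e j))
    have h2 : f (e j) = algebraMap A L (s j) • b j := by
      rw [← he j, algebraMap_smul]; rfl
    simp only [RingHom.mapMatrix_apply, Matrix.map_apply, Matrix.of_apply, h1, h2,
      Matrix.diagonal_apply, map_smul, Basis.coord_apply, Basis.repr_self, smul_eq_mul,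
      Finsupp.single_apply]
    split_ifs with h1 h2 h2
    · subst h1; simp [Algebra.smul_def]
    · exact absurd h1.symm h2
    · exact absurd h2.symm h1
    · simp
  have hdet := congrArg Matrix.det hmat
  rw [← RingHom.map_det, Matrix.det_diagonal, ← map_prod] at hdet
  have hu : IsUnit (algebraMap A L (∏ i, (u i * s i : A))) := by
    simpa using IsLocalization.map_units L (∏ i, u i * s i : S)
  rw [← hdet] at hu
  exact (IsLocalization.AtPrime.isUnit_to_map_iff L p.asIdeal _).1 hu hmem

lemma nonempty_linearEquiv_of_apply_zero_one {A M Q : Type*} [CommRing A] [AddCommGroup M]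
    [Module A M] [AddCommGroup Q] [Module A Q] (σ : (M × A) ≃ₗ[A] (Q × A))
    (h : σ (0, 1) = (0, 1)) : Nonempty (M ≃ₗ[A] Q) := by
  have h' : σ.symm (0, 1) = (0, 1) := by rw [← h, σ.symm_apply_apply]
  have key' : ∀ x, (σ ((σ.symm (x, 0)).1, 0)).1 = x := fun x ↦ by
    have : ((σ.symm (x, 0)).1, (0 : A)) =
        σ.symm (x, 0) - (σ.symm (x, 0)).2 • ((0 : M), (1 : A)) := by
      ext <;> simp
    rw [this, map_sub, map_smul, h, σ.apply_symm_apply]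
    simp
  have key : ∀ x, (σ.symm ((σ (x, 0)).1, 0)).1 = x := fun x ↦ by
    have : ((σ (x, 0)).1, (0 : A)) = σ (x, 0) - (σ (x, 0)).2 • ((0 : Q), (1 : A)) := by
      ext <;> simp
    rw [this, map_sub, map_smul, h', σ.symm_apply_apply]
    simp
  exact ⟨LinearEquiv.ofLinearMap (LinearMap.fst A Q A ∘ₗ σ.toLinearMap ∘ₗ LinearMap.inl A M A)
    (LinearMap.fst A M A ∘ₗ σ.symm.toLinearMap ∘ₗ LinearMap.inl A Q A)
    (LinearMap.ext key') (LinearMap.ext key)⟩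

lemma exists_linearEquiv_add_smul {A M : Type*} [CommRing A] [AddCommGroup M] [Module A M]
    (q : M) : ∃ ε : (M × A) ≃ₗ[A] (M × A), ∀ m b, ε (m, b) = (m + b • q, b) :=
  ⟨LinearEquiv.prodComm A M A ≪≫ₗ
    LinearEquiv.skewProd (.refl A A) (.refl A M) (LinearMap.toSpanSingleton A M q) ≪≫ₗ
    LinearEquiv.prodComm A A M, fun m b ↦ by simp⟩

open Module in
lemma exists_linearEquiv_apply_eq_add_smul {A M : Type*} [CommRing A] [IsNoetherianRing A]
    [AddCommGroup M] [Module A M] {r : ℕ}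
    (hM : ∀ p : Ideal A, p.IsPrime → ∃ (e : Fin r → M) (ψ : Fin r → Dual A M),
      (Matrix.of fun i j ↦ ψ i (e j)).det ∉ p)
    (k : ℕ) (hr : ∀ p : Ideal A, p.IsPrime → p.height < (k + r : ℕ)) (t : A)
    (ht : ∀ p : Ideal A, p.IsPrime → t ∈ p → (k : ℕ∞) ≤ p.height)
    (x : M) (a : A) (θ : Dual A (M × A)) (hθ : θ (x, a) = 1) :
    ∃ (ε : (M × A) ≃ₗ[A] (M × A)) (x' : M) (a' : A), ε (x, a) = (t • x', 1 + t * a') := by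
  obtain ⟨q, hq⟩ := exists_add_smul_unimodular hM k hr a r k le_rfl le_rfl (Ideal.span {t})
    (fun p hp h ↦ ht p hp ((Ideal.span_singleton_le_iff_mem _).1 h)) x (fun p hp _ ha ↦ by
      refine ⟨θ ∘ₗ LinearMap.inl A M A, fun h ↦ hp.ne_top ((Ideal.eq_top_iff_one _).2 ?_)⟩
      have : (x, a) = (x, 0) + a • ((0 : M), (1 : A)) := by simp
      rw [this, map_add, map_smul, smul_eq_mul] at hθ
      rw [← hθ]
      exact add_mem h (Ideal.mul_mem_right _ _ ha))
  obtain ⟨ψ, y, hψ⟩ : ∃ (ψ : Dual A M) (y : A), ψ (x + a • q) = 1 + t * y := by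
    have htop : LinearMap.range (Dual.eval A M (x + a • q)) ⊔ Ideal.span {t} = (⊤ : Ideal A) := by
      by_contra hne
      obtain ⟨p, hp, hle⟩ := Ideal.exists_le_maximal _ hne
      obtain ⟨ψ, hψ⟩ := hq p hp.isPrime (le_sup_right.trans hle)
      exact hψ (hle (Submodule.mem_sup_left ⟨ψ, rfl⟩))
    obtain ⟨_, ⟨ψ, rfl⟩, z, hz, h⟩ := Submodule.mem_sup.1 ((Ideal.eq_top_iff_one _).1 htop)
    obtain ⟨y, rfl⟩ := Ideal.mem_span_singleton'.1 hz
    exact ⟨ψ, -y, by rw [← h, Dual.eval_apply]; ring⟩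
  obtain ⟨ε₁, h₁⟩ := exists_linearEquiv_add_smul (A := A) q
  obtain ⟨ε₂, h₂⟩ := exists_linearEquiv_add_smul (A := A) (-(x + a • q))
  refine ⟨ε₁ ≪≫ₗ LinearEquiv.skewProd (.refl A M) (.refl A A) ((1 - a) • ψ) ≪≫ₗ ε₂,
    -(((1 - a) * y) • (x + a • q)), (1 - a) * y, ?_⟩
  have ha : a + (1 - a) * (1 + t * y) = 1 + t * ((1 - a) * y) := by ring
  simp only [LinearEquiv.trans_apply, h₁, LinearEquiv.skewProd_apply, LinearEquiv.refl_apply,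
    LinearMap.smul_apply, hψ, smul_eq_mul, ha, h₂, Prod.mk.injEq, and_true]
  module

/-- Completing a unimodular vector when the free module of corank one is cancellative. -/
lemma IsCancellative.exists_linearEquiv_apply_eq_single {R : Type} [CommRing R] {d : ℕ}
    (hcan : IsCancellative R (Fin d → R)) (V W : Fin d ⊕ Fin 1 → R) (h : W ⬝ᵥ V = 1) :
    ∃ σ : (Fin d ⊕ Fin 1 → R) ≃ₗ[R] (Fin d ⊕ Fin 1 → R), σ V = Pi.single (Sum.inr 0) 1 := by
  let w : (Fin d ⊕ Fin 1 → R) →ₗ[R] R := dotProductBilin R R W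
  have hw : w V = 1 := h
  let K := LinearMap.ker w
  let pr : (Fin d ⊕ Fin 1 → R) →ₗ[R] K :=
    (LinearMap.id - LinearMap.toSpanSingleton R _ V ∘ₗ w).codRestrict K fun z ↦ by
      simp [K, hw]
  have hpr : pr ∘ₗ K.subtype = LinearMap.id := by
    ext z : 2
    have : w z = 0 := z.2
    simp [pr, this]
  have : Module.Finite R K := Module.Finite.of_surjective pr fun z ↦ ⟨z, congr($hpr z)⟩
  have : Module.Projective R K := Module.Projective.of_split _ _ hpr
  let e₁ : (Fin d ⊕ Fin 1 → R) ≃ₗ[R] K × R :=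
    LinearEquiv.ofLinearMap (pr.prod w)
      (K.subtype.coprod (LinearMap.toSpanSingleton R _ V))
      (by
        apply LinearMap.ext
        rintro ⟨z, c⟩
        have hz : w z = 0 := z.2
        ext <;> simp [pr, hz, hw])
      (by
        apply LinearMap.ext
        intro z
        simp [pr])
  have he₁ : e₁ V = (0, 1) := by
    ext <;> simp [e₁, pr, hw]
  let e₂ := LinearEquiv.sumArrowLequivProdArrow (Fin d) (Fin 1) R R
  obtain ⟨e⟩ := hcan K inferInstance inferInstance 1
    ⟨e₂.symm ≪≫ₗ e₁ ≪≫ₗ (LinearEquiv.refl R K).prodCongr (LinearEquiv.funUnique (Fin 1) R R).symm⟩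
  refine ⟨e₁ ≪≫ₗ e.symm.prodCongr (LinearEquiv.funUnique (Fin 1) R R).symm ≪≫ₗ e₂.symm, ?_⟩
  simp only [LinearEquiv.trans_apply, he₁]
  ext i
  rcases i with i | i
  · simp [e₂]
  · fin_cases i
    simp [e₂]

/-- Let `R` be an `A`-algebra with two retractions `π₀, π₁` onto `A` that agree modulo `r` and are
separated by an element `x` with `x (x - r) = 0`. If free modules over `R` are cancellative, a
unimodular vector congruent to a basis vector modulo `r` can be completed by an automorphism
congruent to the identity modulo `r`. -/
lemma IsCancellative.exists_linearEquiv_apply_eq_add_smul {A R : Type} [CommRing A] [CommRing R]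
    {d : ℕ} {r : A} (hcan : IsCancellative R (Fin d → R)) (ι : A →+* R) (π₀ π₁ : R →+* A) (x : R)
    (hx : x * (x - ι r) = 0) (hπ₁ : ∀ a, π₁ (ι a) = a) (hx₀ : π₀ x = 0) (hx₁ : π₁ x = r)
    (hdvd : ∀ z : R, ∃ y, π₁ z = π₀ z + r * y)
    (u w : Fin d ⊕ Fin 1 → A) (h : w ⬝ᵥ (Pi.single (Sum.inr 0) 1 + r • u) = 1) :
    ∃ (α : (Fin d ⊕ Fin 1 → A) ≃ₗ[A] (Fin d ⊕ Fin 1 → A))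
      (γ : (Fin d ⊕ Fin 1 → A) →ₗ[A] (Fin d ⊕ Fin 1 → A)),
      (∀ z, α z = z + r • γ z) ∧
        α (Pi.single (Sum.inr 0) 1 + r • u) = Pi.single (Sum.inr 0) 1 := by
  classical
  let E : Fin d ⊕ Fin 1 → R := Pi.single (Sum.inr 0) 1
  let V : Fin d ⊕ Fin 1 → R := E + x • (ι ∘ u)
  have hmap : ∀ (S T : Type) [CommRing S] [CommRing T] (f : S →+* T),
      f ∘ (Pi.single (Sum.inr 0) 1 : Fin d ⊕ Fin 1 → S) = Pi.single (Sum.inr 0) 1 := by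
    intro S T _ _ f
    ext i
    by_cases hi : i = Sum.inr 0
    · subst hi; simp
    · simp [hi]
  have hV₀ : π₀ ∘ V = Pi.single (Sum.inr 0) 1 := by
    rw [← hmap R A π₀]
    ext i
    simp [V, E, hx₀]
  have hV₁ : π₁ ∘ V = Pi.single (Sum.inr 0) 1 + r • u := by
    rw [← hmap R A π₁]
    ext i
    simp [V, E, hx₁, hπ₁]
  have hc₀ : E ⬝ᵥ V = 1 + x * ι (u (Sum.inr 0)) := by
    simp [V, E]
  have hc₁ : (ι ∘ w) ⬝ᵥ V = 1 + (x - ι r) * ι (w ⬝ᵥ u) := by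
    have h1 : V = ι ∘ (Pi.single (Sum.inr 0) 1 + r • u) + (x - ι r) • (ι ∘ u) := by
      have h2 : ι ∘ (Pi.single (Sum.inr 0) 1 + r • u) = E + ι r • (ι ∘ u) := by
        ext i
        have := congrFun (hmap A R ι) i
        simp only [Function.comp_apply] at this
        simp [E, this]
      rw [h2]
      simp only [V]
      module
    rw [h1, dotProduct_add, dotProduct_smul, ← RingHom.map_dotProduct, h, map_one,
      ← RingHom.map_dotProduct, smul_eq_mul]
  obtain ⟨σ, hσ⟩ := hcan.exists_linearEquiv_apply_eq_single V
    (E + (1 - E ⬝ᵥ V) • (ι ∘ w)) (by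
      rw [add_dotProduct, smul_dotProduct, hc₀, hc₁, smul_eq_mul]
      linear_combination (-(ι (u (Sum.inr 0)) * ι (w ⬝ᵥ u))) * hx)
  let N := LinearMap.toMatrix' σ.toLinearMap
  let N' := LinearMap.toMatrix' σ.symm.toLinearMap
  have hNN' : N * N' = 1 := by
    simp [N, N', ← LinearMap.toMatrix'_comp]
  have hN'N : N' * N = 1 := by
    simp [N, N', ← LinearMap.toMatrix'_comp]
  have hNV : N.mulVec V = E := by
    rw [← Matrix.toLin'_apply, Matrix.toLin'_toMatrix']; exact hσ
  choose δ hδ using fun i j ↦ hdvd (N i j)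
  have hmul : ∀ (π : R →+* A), π.mapMatrix N * π.mapMatrix N' = 1 ∧
      π.mapMatrix N' * π.mapMatrix N = 1 := fun π ↦ by
    rw [← map_mul π.mapMatrix, ← map_mul π.mapMatrix, hNN', hN'N, map_one]; simp
  have hδ' : π₁.mapMatrix N = π₀.mapMatrix N + r • Matrix.of δ := by
    ext i j
    simp [hδ]
  have hact : ∀ π : R →+* A, (π.mapMatrix N).mulVec (π ∘ V) = Pi.single (Sum.inr 0) 1 := fun π ↦ by
    rw [← hmap R A π]
    ext i
    have := congrArg π (congrFun hNV i)
    rw [RingHom.map_mulVec] at this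
    exact this
  let P := π₀.mapMatrix N' * π₁.mapMatrix N
  let P' := π₁.mapMatrix N' * π₀.mapMatrix N
  have hPP' : P * P' = 1 := by
    simp only [P, P']
    rw [Matrix.mul_assoc, ← Matrix.mul_assoc (π₁.mapMatrix N), (hmul π₁).1, Matrix.one_mul,
      (hmul π₀).2]
  have hP'P : P' * P = 1 := by
    simp only [P, P']
    rw [Matrix.mul_assoc, ← Matrix.mul_assoc (π₀.mapMatrix N), (hmul π₀).1, Matrix.one_mul,
      (hmul π₁).2]
  refine ⟨Matrix.toLin'OfInv hP'P hPP', Matrix.toLin' (π₀.mapMatrix N' * Matrix.of δ),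
    fun z ↦ ?_, ?_⟩
  · have : P = 1 + r • (π₀.mapMatrix N' * Matrix.of δ) := by
      simp only [P]
      rw [hδ', Matrix.mul_add, (hmul π₀).2, Matrix.mul_smul]
    change P.mulVec z = _
    rw [Matrix.toLin'_apply, this, Matrix.add_mulVec, Matrix.one_mulVec, Matrix.smul_mulVec]
  · change P.mulVec _ = _
    have h₀ := hact π₀
    rw [hV₀] at h₀
    rw [← hV₁, ← Matrix.mulVec_mulVec, hact]
    nth_rewrite 1 [← h₀]
    rw [Matrix.mulVec_mulVec, (hmul π₀).2, Matrix.one_mulVec]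

lemma exists_linearEquiv_apply_eq_add_smul_of_isCancellative {A : Type} [CommRing A] {d : ℕ}
    {r : A} (hcan : IsCancellative (A[X] ⧸ Ideal.span {(X : A[X]) ^ 2 - C r * X})
      (Fin d → A[X] ⧸ Ideal.span {(X : A[X]) ^ 2 - C r * X}))
    (u w : Fin d ⊕ Fin 1 → A) (h : w ⬝ᵥ (Pi.single (Sum.inr 0) 1 + r • u) = 1) :
    ∃ (α : (Fin d ⊕ Fin 1 → A) ≃ₗ[A] (Fin d ⊕ Fin 1 → A))
      (γ : (Fin d ⊕ Fin 1 → A) →ₗ[A] (Fin d ⊕ Fin 1 → A)),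
      (∀ z, α z = z + r • γ z) ∧
        α (Pi.single (Sum.inr 0) 1 + r • u) = Pi.single (Sum.inr 0) 1 := by
  set I := Ideal.span {(X : A[X]) ^ 2 - C r * X}
  have hev : ∀ c : A, c ^ 2 - r * c = 0 → ∀ f ∈ I, evalRingHom c f = 0 := fun c hc f hf ↦ by
    obtain ⟨g, rfl⟩ := Ideal.mem_span_singleton'.1 hf
    simp [hc]
  refine hcan.exists_linearEquiv_apply_eq_add_smul ((Ideal.Quotient.mk I).comp C)
    (Ideal.Quotient.lift I (evalRingHom 0) (hev 0 (by ring)))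
    (Ideal.Quotient.lift I (evalRingHom r) (hev r (by ring))) (Ideal.Quotient.mk I X)
    ?_ (fun a ↦ ?_) ?_ ?_ (fun z ↦ ?_) u w h
  · rw [RingHom.comp_apply, ← map_sub, ← map_mul, Ideal.Quotient.eq_zero_iff_mem]
    exact Ideal.mem_span_singleton'.2 ⟨1, by ring⟩
  · rw [RingHom.comp_apply, Ideal.Quotient.lift_mk]; simp
  · rw [Ideal.Quotient.lift_mk]; simp
  · rw [Ideal.Quotient.lift_mk]; simp
  · obtain ⟨f, rfl⟩ := Ideal.Quotient.mk_surjective z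
    obtain ⟨y, hy⟩ := sub_dvd_eval_sub r 0 f
    refine ⟨y, ?_⟩
    rw [Ideal.Quotient.lift_mk, Ideal.Quotient.lift_mk]
    simpa [sub_eq_iff_eq_add'] using hy

/-- Transport of an automorphism congruent to the identity modulo `r` along a pair of maps with
`G ∘ F` equal to multiplication by `r`. -/
lemma exists_linearEquiv_apply_eq_of_comp_eq_smul {A V N : Type*} [CommRing A] [AddCommGroup V]
    [Module A V] [AddCommGroup N] [Module A N] {r : A} (F : V →ₗ[A] N) (G : N →ₗ[A] V)
    (hGF : ∀ v, G (F v) = r • v) (α : V ≃ₗ[A] V) (γ : V →ₗ[A] V)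
    (hα : ∀ v, α v = v + r • γ v) : ∃ β : N ≃ₗ[A] N, ∀ v, β (F v) = F (α v) := by
  refine ⟨LinearEquiv.ofLinearMap (LinearMap.id + F ∘ₗ γ ∘ₗ G)
    (LinearMap.id - F ∘ₗ α.symm.toLinearMap ∘ₗ γ ∘ₗ G) ?_ ?_, fun v ↦ ?_⟩
  · apply LinearMap.ext
    intro n
    have h := hα (α.symm (γ (G n)))
    rw [α.apply_symm_apply] at h
    simp only [LinearMap.comp_apply, LinearMap.add_apply, LinearMap.sub_apply, LinearMap.id_apply,
      map_sub, hGF, map_smul, LinearEquiv.coe_coe]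
    have h' := congrArg F h
    simp only [map_add, map_smul] at h'
    rw [h']; module
  · apply LinearMap.ext
    intro n
    have h : α.symm (γ (G n) + r • γ (γ (G n))) = γ (G n) := by
      rw [← hα, α.symm_apply_apply]
    have h' := congrArg F h
    simp only [map_add, map_smul] at h'
    simp only [LinearMap.comp_apply, LinearMap.add_apply, LinearMap.sub_apply, LinearMap.id_apply,
      map_add, hGF, map_smul, LinearEquiv.coe_coe]
    rw [← h']; module
  · simp [hGF, hα]

lemma one_le_height_of_mem_of_mk_mem_nonZeroDivisors {A : Type*} [CommRing A] {s : A}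
    (hs : Ideal.Quotient.mk (nilradical A) s ∈ nonZeroDivisors (A ⧸ nilradical A))
    {p : Ideal A} (hp : p.IsPrime) (hsp : s ∈ p) : 1 ≤ p.height := by
  rw [Order.one_le_iff_ne_zero, Ne, Ideal.height_eq_zero_iff]
  intro hmin
  have hmin' : p ∈ (nilradical A).minimalPrimes := by
    rw [nilradical, Ideal.radical_minimalPrimes]
    exact hmin
  rw [Ideal.minimalPrimes_eq_comap] at hmin'
  obtain ⟨q, hq, rfl⟩ := hmin'
  exact notMem_nonZeroDivisors_of_mem_mem_minimalPrimes (Ideal.mem_comap.1 hsp) hq hs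

lemma rankAtStalk_prod_pi_fin {A M : Type*} [CommRing A] [AddCommGroup M] [Module A M]
    [Module.Finite A M] [Module.Projective A M] (m : ℕ) (p : PrimeSpectrum A) :
    Module.rankAtStalk (M × (Fin m → A)) p = Module.rankAtStalk M p + m := by
  have := p.nontrivial
  rw [Module.rankAtStalk_prod]
  simp

/-- Bass cancellation: a projective module whose rank exceeds all heights of primes cancels a
free summand of rank one. -/
lemma nonempty_linearEquiv_of_height_lt_rank {A M Q : Type*} [CommRing A] [IsNoetherianRing A]
    [AddCommGroup M] [Module A M] [Module.Finite A M] [Module.Projective A M] [AddCommGroup Q]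
    [Module A Q] {r : ℕ} (hM : ∀ p : PrimeSpectrum A, Module.rankAtStalk M p = r)
    (hr : ∀ p : Ideal A, p.IsPrime → p.height < r) (e : (M × A) ≃ₗ[A] (Q × A)) :
    Nonempty (M ≃ₗ[A] Q) := by
  obtain ⟨ε, x', a', h⟩ := exists_linearEquiv_apply_eq_add_smul
    (fun p hp ↦ exists_dual_det_notMem ⟨p, hp⟩ (hM ⟨p, hp⟩)) 0 (by simpa using hr) 0 (by simp)
    (e.symm (0, 1)).1 (e.symm (0, 1)).2 (LinearMap.snd A Q A ∘ₗ e.toLinearMap) (by simp)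
  refine nonempty_linearEquiv_of_apply_zero_one (ε.symm ≪≫ₗ e) ?_
  have h' : ε (e.symm (0, 1)) = (0, 1) := by simpa using h
  rw [LinearEquiv.trans_apply, ← h', ε.symm_apply_apply, e.apply_symm_apply]

lemma nonempty_prod_linearEquiv_of_height_le_rank {A M Q : Type*} [CommRing A]
    [IsNoetherianRing A] [AddCommGroup M] [Module A M] [Module.Finite A M] [Module.Projective A M]
    [AddCommGroup Q] [Module A Q] {r : ℕ} (hM : ∀ p : PrimeSpectrum A, Module.rankAtStalk M p = r)
    (hr : ∀ p : Ideal A, p.IsPrime → p.height ≤ r) (m : ℕ)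
    (e : (M × (Fin (m + 1) → A)) ≃ₗ[A] (Q × (Fin (m + 1) → A))) :
    Nonempty ((M × A) ≃ₗ[A] (Q × A)) := by
  induction m with
  | zero =>
    let f := LinearEquiv.funUnique (Fin 1) A A
    exact ⟨(LinearEquiv.refl A M).prodCongr f.symm ≪≫ₗ e ≪≫ₗ (LinearEquiv.refl A Q).prodCongr f⟩
  | succ m ih =>
    let f : (Fin (m + 1 + 1) → A) ≃ₗ[A] (Fin (m + 1) → A) × A :=
      (Fin.consLinearEquiv A fun _ ↦ A).symm ≪≫ₗ LinearEquiv.prodComm A _ _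
    obtain ⟨e'⟩ := nonempty_linearEquiv_of_height_lt_rank (r := r + (m + 1))
      (fun p ↦ by rw [rankAtStalk_prod_pi_fin, hM p])
      (fun p hp ↦ (hr p hp).trans_lt (by exact_mod_cast (by omega)))
      ((LinearEquiv.prodAssoc A M _ A) ≪≫ₗ (LinearEquiv.refl A M).prodCongr f.symm ≪≫ₗ e ≪≫ₗ
        (LinearEquiv.refl A Q).prodCongr f ≪≫ₗ (LinearEquiv.prodAssoc A Q _ A).symm)
    exact ih e'

theorem statement1
    (A : Type) [CommRing A] [IsNoetherianRing A] (d : ℕ) (hdim : ringKrullDim A = d)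
    (P : Type) [AddCommGroup P] [Module A P] [Module.Finite A P] [Module.Projective A P]
    (hrank : HasRank A P d) (s : A)
    -- (i) `P_s` is free over `A_s`
    (hfree : Module.Free (Localization.Away s)
      (LocalizedModule (Submonoid.powers s) P))
    -- (ii) `φ i (p j) = δ_{ij} • s`
    (p : Fin d → P) (φ : Fin d → (P →ₗ[A] A))
    (hdiag : ∀ i j, φ i (p j) = if i = j then s else 0)
    -- (iii) `sP ⊆ p_1 A + … + p_d A`
    (hspan : ∀ x : P, s • x ∈ Submodule.span A (Set.range p))
    -- (iv) the image of `s` in `A_red` is a non-zero-divisor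
    (hnzd : (Ideal.Quotient.mk (nilradical A) s) ∈ nonZeroDivisors (A ⧸ nilradical A))
    -- (v) `(0 : sA) = (0 : s²A)`
    (hann : {a : A | s * a = 0} = {a : A | s ^ 2 * a = 0})
    -- the free module of rank `d` over `R = A[X]/(X² - s²X)` is cancellative
    (hcan : IsCancellative (A[X] ⧸ Ideal.span {(X : A[X]) ^ 2 - C (s ^ 2) * X})
      (Fin d → A[X] ⧸ Ideal.span {(X : A[X]) ^ 2 - C (s ^ 2) * X})) :
    IsCancellative A P := by
  classical
  have hheight : ∀ q : Ideal A, q.IsPrime → q.height ≤ d := fun q hq ↦ by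
    have := Ideal.height_le_ringKrullDim_of_ne_top hq.ne_top
    rw [hdim] at this
    exact_mod_cast this
  intro Q _ _ _ _ m ⟨e⟩
  cases m with
  | zero =>
    exact ⟨(LinearEquiv.prodUnique (R := A) (M := P) (M₂ := Fin 0 → A)).symm ≪≫ₗ e ≪≫ₗ
      LinearEquiv.prodUnique⟩
  | succ m =>
    obtain ⟨e⟩ := nonempty_prod_linearEquiv_of_height_le_rank hrank hheight m e
    obtain ⟨ε, x, a, hε⟩ := exists_linearEquiv_apply_eq_add_smul
      (fun q hq ↦ exists_dual_det_notMem ⟨q, hq⟩ (hrank ⟨q, hq⟩)) 1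
      (fun q hq ↦ (hheight q hq).trans_lt (by exact_mod_cast (by omega))) (s ^ 4)
      (fun q hq hs ↦ by
        simpa using one_le_height_of_mem_of_mk_mem_nonZeroDivisors hnzd hq (hq.mem_of_pow_mem _ hs))
      (e.symm (0, 1)).1 (e.symm (0, 1)).2 (LinearMap.snd A Q A ∘ₗ e.toLinearMap) (by simp)
    obtain ⟨y, hy⟩ := (Submodule.mem_span_range_iff_exists_fun A).1 (hspan x)
    let f : Fin d ⊕ Fin 1 → P × A := Sum.elim (fun i ↦ (s • p i, 0)) fun _ ↦ (0, 1)
    let F := Fintype.linearCombination A f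
    let G : P × A →ₗ[A] (Fin d ⊕ Fin 1 → A) := LinearMap.pi
      (Sum.elim (fun i ↦ φ i ∘ₗ LinearMap.fst A P A) fun _ ↦ s ^ 2 • LinearMap.snd A P A)
    have hGF : ∀ v, G (F v) = s ^ 2 • v := by
      intro v
      have : G ∘ₗ F = s ^ 2 • LinearMap.id := by
        ext j i
        rcases j with j | j <;> rcases i with i | i
        · simp [F, G, f, hdiag, Pi.single_apply, pow_two]
        · simp [F, G, f]
        · simp [F, G, f]
        · fin_cases i; fin_cases j
          simp [F, G, f]
      simpa using congr($this v)
    let u : Fin d ⊕ Fin 1 → A := Sum.elim y fun _ ↦ s ^ 2 * a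
    let v : Fin d ⊕ Fin 1 → A := Pi.single (Sum.inr 0) 1 + s ^ 2 • u
    have hFv : F v = ε (e.symm (0, 1)) := by
      rw [show ε (e.symm (0, 1)) = _ from hε, show s ^ 4 • x = s ^ 3 • s • x by module, ← hy]
      simp only [F, Fintype.linearCombination_apply, Fintype.sum_sum_type, v, u, f]
      ext
      · simp [Finset.smul_sum, smul_smul, Prod.fst_sum]
        refine Finset.sum_congr rfl fun i _ ↦ ?_
        congr 1; ring
      · simp [Prod.snd_sum]
        ring
    let θ : P × A →ₗ[A] A := LinearMap.snd A Q A ∘ₗ e.toLinearMap ∘ₗ ε.symm.toLinearMap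
    obtain ⟨α, γ, hα, hαv⟩ := exists_linearEquiv_apply_eq_add_smul_of_isCancellative hcan u (θ ∘ f)
      (by
        have h1 : θ (F v) = 1 := by rw [hFv]; simp [θ]
        refine Eq.trans ?_ h1
        simp only [F, Fintype.linearCombination_apply, map_sum, map_smul, dotProduct,
          Function.comp_apply, smul_eq_mul, v, mul_comm])
    obtain ⟨β, hβ⟩ := exists_linearEquiv_apply_eq_of_comp_eq_smul F G hGF α γ hα
    refine nonempty_linearEquiv_of_apply_zero_one (β.symm ≪≫ₗ ε.symm ≪≫ₗ e) ?_
    have h1 : β (ε (e.symm (0, 1))) = (0, 1) := by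
      rw [← hFv, hβ, hαv]
      simp [F, f, Fintype.linearCombination_apply_single]
    rw [LinearEquiv.trans_apply, ← h1]
    simp
end

section
/- Let A be a commutative Noetherian ring of Krull dimension d. Assume that for every finite ring extension R of A (i.e. every commutative ring R containing A as a subring such that R is finitely generated as an A-module), the free R-module of rank d is cancellative. Then every finitely generated projective A-module of rank d is cancellative. -/
section LinearAlgebra

open Module

variable {K : Type*} [Field K]

theorem Matrix.exists_linearIndependent_rows_of_le_rank {ι n : Type*} [Finite ι] [Fintype n]
    (M : Matrix ι n K) {k : ℕ} (h : k ≤ M.rank) :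
    ∃ I : Fin k → ι, LinearIndependent K (M.row ∘ I) := by
  obtain ⟨κ, a, ha, hspan, hli⟩ := exists_linearIndependent' K M.row
  have : Finite κ := Finite.of_injective a ha
  have : Fintype κ := Fintype.ofFinite κ
  rw [Matrix.rank_eq_finrank_span_row, ← hspan, finrank_span_eq_card hli] at h
  obtain ⟨b⟩ := Function.Embedding.nonempty_of_card_le (α := Fin k) (β := κ) (by simpa using h)
  exact ⟨a ∘ b, hli.comp b b.injective⟩

/-- The span of a finite family of vectors of `Kⁿ` has dimension at least `k` if and only if some
`k × k` minor of the family does not vanish. -/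
theorem le_finrank_span_iff_exists_det_ne_zero {ι n : Type*} [Finite ι] [Fintype n]
    (v : ι → n → K) (k : ℕ) :
    k ≤ finrank K (Submodule.span K (Set.range v)) ↔
      ∃ (I : Fin k → ι) (J : Fin k → n), (Matrix.of fun i j => v (I i) (J j)).det ≠ 0 := by
  constructor
  · intro h
    obtain ⟨I, hI⟩ := (Matrix.of v).exists_linearIndependent_rows_of_le_rank (k := k) (by
      rw [Matrix.rank_eq_finrank_span_row]; exact h)
    have hrank : ((Matrix.of v).submatrix I id).rank = k := by
      simpa using LinearIndependent.rank_matrix (M := (Matrix.of v).submatrix I id) hI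
    obtain ⟨J, hJ⟩ := ((Matrix.of v).submatrix I
      id).transpose.exists_linearIndependent_rows_of_le_rank (k := k) (by
      rw [Matrix.rank_transpose, hrank])
    refine ⟨I, J, ?_⟩
    have : IsUnit (Matrix.of fun i j => v (I j) (J i)) :=
      Matrix.linearIndependent_rows_iff_isUnit.mp hJ
    rw [Matrix.isUnit_iff_isUnit_det] at this
    rw [← Matrix.det_transpose]
    exact this.ne_zero
  · rintro ⟨I, J, h⟩
    have hu : IsUnit ((Matrix.of v).submatrix I J) := by
      rw [Matrix.isUnit_iff_isUnit_det]
      exact isUnit_iff_ne_zero.mpr h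
    have h1 := Matrix.rank_of_isUnit _ hu
    have h2 := (Matrix.of v).rank_submatrix_le I J
    rw [h1, Matrix.rank_eq_finrank_span_row, Fintype.card_fin] at h2
    exact h2

/-- If a finite family `y` together with `w` spans a space of dimension at most the cardinality of
`y`, then adding suitable multiples of `w` to the members of `y` produces a spanning family. -/
theorem exists_span_range_add_smul_ge {W ι : Type*} [AddCommGroup W] [Module K W] [Fintype ι]
    (y : ι → W) (w : W) (b : K) (hb : b ≠ 0)
    (h : finrank K (Submodule.span K (insert w (Set.range y))) ≤ Fintype.card ι) :
    ∃ s : Set ι, Submodule.span K (insert w (Set.range y)) ≤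
      Submodule.span K (Set.range fun i => y i + (b * s.indicator 1 i) • w) := by
  classical
  by_cases hw : w ∈ Submodule.span K (Set.range y)
  · refine ⟨∅, ?_⟩
    simp [Submodule.span_insert_eq_span hw]
  have hdep : ¬ LinearIndependent K y := by
    intro hli
    have h1 := finrank_span_eq_card hli
    have hlt : Submodule.span K (Set.range y) < Submodule.span K (insert w (Set.range y)) :=
      lt_of_le_of_ne (Submodule.span_mono (Set.subset_insert _ _)) fun he =>
        hw (he ▸ Submodule.subset_span (Set.mem_insert _ _))
    have : FiniteDimensional K (Submodule.span K (insert w (Set.range y))) :=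
      FiniteDimensional.span_of_finite K ((Set.finite_range y).insert w)
    have := Submodule.finrank_lt_finrank_of_lt hlt
    omega
  obtain ⟨g, hg, i₀, hi₀⟩ := Fintype.not_linearIndependent_iff.mp hdep
  refine ⟨{i₀}, ?_⟩
  set z : ι → W := fun i => y i + (b * ({i₀} : Set ι).indicator 1 i) • w with hz
  have hzmem : ∀ i, z i ∈ Submodule.span K (Set.range z) :=
    fun i => Submodule.subset_span ⟨i, rfl⟩
  have hsum : ∑ i, g i • z i = (g i₀ * b) • w := by
    simp only [hz, smul_add, Finset.sum_add_distrib, hg, zero_add]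
    rw [Finset.sum_eq_single i₀]
    · simp [smul_smul]
    · intro i _ hi
      simp [hi]
    · simp
  have hwmem : w ∈ Submodule.span K (Set.range z) := by
    rw [← Submodule.smul_mem_iff _ (mul_ne_zero hi₀ hb), ← hsum]
    exact Submodule.sum_mem _ fun i _ => Submodule.smul_mem _ _ (hzmem i)
  rw [Submodule.span_le, Set.insert_subset_iff]
  refine ⟨hwmem, ?_⟩
  rintro _ ⟨i, rfl⟩
  have : y i = z i - (b * ({i₀} : Set ι).indicator 1 i) • w := by simp [hz]
  rw [this]
  exact Submodule.sub_mem _ (hzmem i) (Submodule.smul_mem _ _ hwmem)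

end LinearAlgebra

section BasicElements

open Module

variable {A : Type*} [CommRing A] {P : Type*} [AddCommGroup P] [Module A P]

/-- The reduction of a linear map `P → Aⁿ` at a prime ideal, with values in a vector space over the
residue field. -/
noncomputable def fiberMap {n : Type*} (f : P →ₗ[A] (n → A)) (p : PrimeSpectrum A) :
    P →ₗ[A] (n → p.asIdeal.ResidueField) :=
  (Algebra.linearMap A p.asIdeal.ResidueField).compLeft n ∘ₗ f

theorem fiberMap_apply {n : Type*} (f : P →ₗ[A] (n → A)) (p : PrimeSpectrum A) (x : P) (j : n) :
    fiberMap f p x j = algebraMap A p.asIdeal.ResidueField (f x j) := rfl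

theorem algebraMap_residueField_ne_zero {p : PrimeSpectrum A} {a : A} (h : a ∉ p.asIdeal) :
    algebraMap A p.asIdeal.ResidueField a ≠ 0 :=
  fun h0 => h (Ideal.algebraMap_residueField_eq_zero.mp h0)

theorem exists_coeff_span_fiberMap_ge {n ι : Type*} [Finite n] [Fintype ι]
    (f : P →ₗ[A] (n → A)) (a : A) (y : ι → P) (w : P) (S : Finset (PrimeSpectrum A))
    (ha : ∀ p ∈ S, a ∉ p.asIdeal)
    (hS : ∀ p ∈ S, finrank p.asIdeal.ResidueField (Submodule.span p.asIdeal.ResidueField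
      (insert (fiberMap f p w) (Set.range fun i => fiberMap f p (y i)))) ≤ Fintype.card ι) :
    ∃ c : ι → A, ∀ p ∈ S,
      Submodule.span p.asIdeal.ResidueField
        (insert (fiberMap f p w) (Set.range fun i => fiberMap f p (y i))) ≤
      Submodule.span p.asIdeal.ResidueField
        (Set.range fun i => fiberMap f p (y i + (a * c i) • w)) := by
  classical
  induction S using Finset.strongInduction with
  | H S ih =>
  rcases S.eq_empty_or_nonempty with rfl | hne
  · exact ⟨0, by simp⟩
  obtain ⟨p, hp⟩ := S.exists_minimal hne
  obtain ⟨c, hc⟩ := ih (S.erase p) (Finset.erase_ssubset hp.prop)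
    (fun q hq => ha q (Finset.mem_of_mem_erase hq)) (fun q hq => hS q (Finset.mem_of_mem_erase hq))
  have hnot : ¬ (S.erase p).prod PrimeSpectrum.asIdeal ≤ p.asIdeal := by
    rw [p.isPrime.prod_le]
    rintro ⟨q, hq, hqp⟩
    exact Finset.ne_of_mem_erase hq
      (le_antisymm hqp (hp.le_of_le (Finset.mem_of_mem_erase hq) hqp))
  obtain ⟨t, ht, htp⟩ := SetLike.not_le_iff_exists.mp hnot
  have htq : ∀ q ∈ S.erase p, t ∈ q.asIdeal := fun q hq =>
    Ideal.prod_le_inf.trans (Finset.inf_le hq) ht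
  set k := p.asIdeal.ResidueField
  set z : ι → P := fun i => y i + (a * c i) • w with hz
  have hspan : Submodule.span k (insert (fiberMap f p w) (Set.range fun i => fiberMap f p (y i))) =
      Submodule.span k (insert (fiberMap f p w) (Set.range fun i => fiberMap f p (z i))) := by
    have key : ∀ (u v : ι → P) (e : ι → A), (∀ i, v i = u i + e i • w) →
        Submodule.span k (insert (fiberMap f p w) (Set.range fun i => fiberMap f p (v i))) ≤
        Submodule.span k (insert (fiberMap f p w) (Set.range fun i => fiberMap f p (u i))) := by
      intro u v e h
      rw [Submodule.span_le, Set.insert_subset_iff]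
      refine ⟨Submodule.subset_span (Set.mem_insert _ _), ?_⟩
      rintro _ ⟨i, rfl⟩
      simp only [h, map_add, map_smul]
      refine Submodule.add_mem _ (Submodule.subset_span (Set.mem_insert_of_mem _ ⟨i, rfl⟩)) ?_
      rw [algebra_compatible_smul k]
      exact Submodule.smul_mem _ _ (Submodule.subset_span (Set.mem_insert _ _))
    refine le_antisymm (key z y (fun i => - (a * c i)) fun i => ?_)
      (key y z (fun i => a * c i) fun i => rfl)
    simp [hz]
  obtain ⟨s, hs⟩ := exists_span_range_add_smul_ge (fun i => fiberMap f p (z i)) (fiberMap f p w)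
    (algebraMap A k (a * t))
    (algebraMap_residueField_ne_zero fun h => (p.isPrime.mem_or_mem h).elim (ha p hp.prop) htp)
    (hspan ▸ hS p hp.prop)
  have hyz : ∀ i, y i + (a * (c i + t * s.indicator 1 i)) • w =
      z i + (a * t * s.indicator 1 i) • w := fun i => by
    rw [hz]; module
  clear_value z
  refine ⟨fun i => c i + t * s.indicator 1 i, fun q hq => ?_⟩
  by_cases hqp : q = p
  · subst hqp
    rw [hspan]
    refine hs.trans_eq ?_
    congr 2
    funext i
    rw [hyz, map_add, map_smul,
      algebra_compatible_smul k (a * t * s.indicator 1 i), map_mul (algebraMap A k)]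
    by_cases hi : i ∈ s <;> simp [hi, k]
  · have hq' : q ∈ S.erase p := Finset.mem_erase.mpr ⟨hqp, hq⟩
    refine (hc q hq').trans_eq ?_
    congr 2
    funext i
    have h0 : algebraMap A q.asIdeal.ResidueField t = 0 :=
      Ideal.algebraMap_residueField_eq_zero.mpr (htq q hq')
    simp only [map_add, map_smul]
    rw [algebra_compatible_smul q.asIdeal.ResidueField,
      algebra_compatible_smul q.asIdeal.ResidueField (a * (c i + _))]
    simp [h0]

/-- A prime `p` containing `t` and not `a` at which the rank of a family is exactly `e p + 1` is
minimal among the primes at which all minors of size `e p + 2` vanish, so there are finitely many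
of them. -/
theorem finite_setOf_finrank_span_fiberMap_eq [IsNoetherianRing A] {n ι : Type*} [Fintype n]
    [Finite ι] (f : P →ₗ[A] (n → A)) (t a : A) (e : PrimeSpectrum A → ℕ) (he : StrictAnti e)
    (x : ι → P) (u : ℕ)
    (hx : ∀ p : PrimeSpectrum A, t ∈ p.asIdeal → a ∉ p.asIdeal → min (u + 1) (e p + 1) ≤
      finrank p.asIdeal.ResidueField (Submodule.span p.asIdeal.ResidueField
        (Set.range fun i => fiberMap f p (x i)))) :
    {p : PrimeSpectrum A | t ∈ p.asIdeal ∧ a ∉ p.asIdeal ∧ e p + 1 ≤ u ∧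
      finrank p.asIdeal.ResidueField (Submodule.span p.asIdeal.ResidueField
        (Set.range fun i => fiberMap f p (x i))) = e p + 1}.Finite := by
  let minors (r : ℕ) : Set A :=
    Set.range fun IJ : (Fin r → ι) × (Fin r → n) =>
      (Matrix.of fun i j => f (x (IJ.1 i)) (IJ.2 j)).det
  have minors_iff : ∀ (r : ℕ) (p : PrimeSpectrum A), minors r ⊆ p.asIdeal ↔
      ¬ r ≤ finrank p.asIdeal.ResidueField (Submodule.span p.asIdeal.ResidueField
        (Set.range fun i => fiberMap f p (x i))) := by
    intro r p
    rw [le_finrank_span_iff_exists_det_ne_zero]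
    have hmap : ∀ (I : Fin r → ι) (J : Fin r → n),
        (Matrix.of fun i j => fiberMap f p (x (I i)) (J j)).det =
          algebraMap A p.asIdeal.ResidueField
            (Matrix.of fun i j => f (x (I i)) (J j)).det := by
      intro I J
      rw [RingHom.map_det]
      rfl
    simp only [hmap, not_exists, not_not, Ideal.algebraMap_residueField_eq_zero]
    constructor
    · intro h I J
      exact h ⟨(I, J), rfl⟩
    · rintro h _ ⟨⟨I, J⟩, rfl⟩
      exact h I J
  refine ((Set.finite_Iic u).biUnion fun r _ =>
    ((Ideal.span (insert t (minors (r + 2)))).finite_minimalPrimes_of_isNoetherianRing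
      A).preimage (f := PrimeSpectrum.asIdeal)
      (fun p _ q _ h => PrimeSpectrum.ext h)).subset ?_
  rintro p ⟨htp, hap, hle, hrank⟩
  refine Set.mem_biUnion (x := e p) (Set.mem_Iic.mpr (by omega)) ?_
  refine ⟨⟨p.isPrime, ?_⟩, ?_⟩
  · rw [Ideal.span_le, Set.insert_subset_iff]
    exact ⟨htp, (minors_iff _ p).mpr (by omega)⟩
  · rintro q ⟨hq, hIq⟩ hqp
    by_contra hpq
    let Q : PrimeSpectrum A := ⟨q, hq⟩
    have hlt : Q < p := lt_of_le_not_ge hqp hpq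
    have heq := he hlt
    rw [Ideal.span_le, Set.insert_subset_iff] at hIq
    have h1 := hx Q hIq.1 fun h => hap (hqp h)
    have h2 := (minors_iff _ Q).mp hIq.2
    omega

theorem exists_fiberMap_add_smul_ne_zero [IsNoetherianRing A] {n : Type*} [Fintype n]
    (f : P →ₗ[A] (n → A)) (t a : A) (e : PrimeSpectrum A → ℕ) (he : StrictAnti e)
    (u : ℕ) (x : Fin (u + 1) → P)
    (hx : ∀ p : PrimeSpectrum A, t ∈ p.asIdeal → a ∉ p.asIdeal → min (u + 1) (e p + 1) ≤
      finrank p.asIdeal.ResidueField (Submodule.span p.asIdeal.ResidueField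
        (Set.range fun i => fiberMap f p (x i)))) :
    ∃ q : P, ∀ p : PrimeSpectrum A, t ∈ p.asIdeal → a ∉ p.asIdeal →
      fiberMap f p (x 0 + a • q) ≠ 0 := by
  induction u with
  | zero =>
    refine ⟨0, fun p htp hap h0 => ?_⟩
    have h := hx p htp hap
    have hzero : (fun i => fiberMap f p (x i)) = 0 := by
      funext i
      rw [show i = 0 from Fin.ext (by omega)]
      simpa using h0
    have hspan : Submodule.span p.asIdeal.ResidueField
        (Set.range fun i => fiberMap f p (x i)) = ⊥ := by
      rw [hzero, Submodule.span_eq_bot]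
      rintro _ ⟨i, rfl⟩
      rfl
    rw [hspan, finrank_bot] at h
    omega
  | succ u ih =>
    have hfin := finite_setOf_finrank_span_fiberMap_eq f t a e he x (u + 1) hx
    have hins : ∀ p : PrimeSpectrum A, (Set.range fun i => fiberMap f p (x i)) =
        insert (fiberMap f p (x (Fin.last _)))
          (Set.range fun i : Fin (u + 1) => fiberMap f p (x i.castSucc)) := by
      intro p
      ext z
      constructor
      · rintro ⟨i, rfl⟩
        induction i using Fin.lastCases with
        | last => exact Set.mem_insert _ _
        | cast i => exact Set.mem_insert_of_mem _ ⟨i, rfl⟩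
      · rintro (rfl | ⟨i, rfl⟩)
        · exact ⟨_, rfl⟩
        · exact ⟨_, rfl⟩
    obtain ⟨c, hc⟩ := exists_coeff_span_fiberMap_ge f a (fun i : Fin (u + 1) => x i.castSucc)
      (x (Fin.last _)) hfin.toFinset (fun p hp => by
        rw [Set.Finite.mem_toFinset] at hp; exact hp.2.1) (fun p hp => by
        rw [Set.Finite.mem_toFinset] at hp
        rw [← hins, Fintype.card_fin, hp.2.2.2]
        exact hp.2.2.1)
    simp only [← hins] at hc
    obtain ⟨q, hq⟩ := ih (fun i => x i.castSucc + (a * c i) • x (Fin.last _)) (by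
      intro p htp hap
      have h := hx p htp hap
      obtain ⟨N, hN⟩ : ∃ N, N = Submodule.span p.asIdeal.ResidueField (Set.range fun i =>
        fiberMap f p (x (Fin.castSucc i) + (a * c i) • x (Fin.last _))) := ⟨_, rfl⟩
      rw [← hN]
      by_cases hp : p ∈ hfin.toFinset
      · have := Submodule.finrank_mono (hc p hp)
        rw [← hN] at this
        omega
      · have hle : Submodule.span p.asIdeal.ResidueField (Set.range fun i => fiberMap f p (x i)) ≤
            N ⊔ Submodule.span p.asIdeal.ResidueField {fiberMap f p (x (Fin.last _))} := by
          have hlast : fiberMap f p (x (Fin.last _)) ∈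
              N ⊔ p.asIdeal.ResidueField ∙ fiberMap f p (x (Fin.last _)) :=
            Submodule.mem_sup_right (Submodule.mem_span_singleton_self _)
          rw [hins, Submodule.span_le, Set.insert_subset_iff]
          refine ⟨hlast, ?_⟩
          rintro _ ⟨i, rfl⟩
          have hi : fiberMap f p (x i.castSucc) =
              fiberMap f p (x i.castSucc + (a * c i) • x (Fin.last _)) -
                algebraMap A p.asIdeal.ResidueField (a * c i) • fiberMap f p (x (Fin.last _)) := by
            rw [map_add, map_smul, ← algebra_compatible_smul p.asIdeal.ResidueField,
              add_sub_cancel_right]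
          simp only [SetLike.mem_coe]
          rw [hi]
          exact Submodule.sub_mem _ (Submodule.mem_sup_left (hN ▸ Submodule.subset_span ⟨i, rfl⟩))
            (Submodule.smul_mem _ _ hlast)
        have h1 := Submodule.finrank_mono hle
        have h2 := Submodule.finrank_add_le_finrank_add_finrank N
          (Submodule.span p.asIdeal.ResidueField {fiberMap f p (x (Fin.last _))})
        have h3 := finrank_span_le_card (R := p.asIdeal.ResidueField)
          {fiberMap f p (x (Fin.last _))}
        simp only [Set.toFinset_singleton, Finset.card_singleton] at h3
        rw [Set.Finite.mem_toFinset] at hp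
        have hp' : e p + 1 ≤ u + 1 →
            finrank p.asIdeal.ResidueField (Submodule.span p.asIdeal.ResidueField
              (Set.range fun i => fiberMap f p (x i))) ≠ e p + 1 :=
          fun h4 h5 => hp ⟨htp, hap, h4, h5⟩
        omega)
    refine ⟨c 0 • x (Fin.last _) + q, fun p htp hap => ?_⟩
    convert hq p htp hap using 2
    rw [Fin.castSucc_zero]
    module

theorem rankAtStalk_le_finrank_span_fiberMap {n ι : Type*} [Fintype n] [Finite ι]
    [Module.Finite A P] [Module.Flat A P] (f : P →ₗ[A] (n → A)) (g : (n → A) →ₗ[A] P)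
    (hgf : g ∘ₗ f = LinearMap.id) (x : ι → P) (hx : Submodule.span A (Set.range x) = ⊤)
    (p : PrimeSpectrum A) :
    rankAtStalk P p ≤ finrank p.asIdeal.ResidueField (Submodule.span p.asIdeal.ResidueField
      (Set.range fun i => fiberMap f p (x i))) := by
  classical
  set k := p.asIdeal.ResidueField
  let L := LinearMap.liftBaseChange k (fiberMap f p)
  have hL : L = (TensorProduct.piScalarRight A k k n).toLinearMap ∘ₗ f.baseChange k := by
    ext y j
    simp [L, fiberMap_apply, Algebra.smul_def, k]
  have hinj : Function.Injective L := by
    rw [hL, LinearMap.coe_comp]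
    refine (TensorProduct.piScalarRight A k k n).injective.comp ?_
    refine Function.LeftInverse.injective (g := g.baseChange k) fun y => ?_
    rw [← LinearMap.comp_apply, ← LinearMap.baseChange_comp, hgf, LinearMap.baseChange_id]
    rfl
  rw [rankAtStalk_eq, ← LinearMap.finrank_range_of_inj hinj, LinearMap.range_liftBaseChange]
  refine Submodule.finrank_mono ?_
  rw [Submodule.span_le]
  rintro _ ⟨y, rfl⟩
  have hy : y ∈ Submodule.span A (Set.range x) := hx ▸ Submodule.mem_top
  have := Submodule.mem_map_of_mem (f := fiberMap f p) hy
  rw [Submodule.map_span, ← Set.range_comp] at this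
  exact Submodule.span_le_restrictScalars A k _ this

/-- Relative form of Bass's theorem on unimodular elements: if the rank of `P` exceeds the
coheight-like function `e` at all primes containing `t`, then for each unimodular `(x, a)` in
`P × A` some `x + a q` is unimodular modulo `t`. -/
theorem exists_add_smul_unimodular_mod [IsNoetherianRing A] [Module.Finite A P]
    [Module.Projective A P] (t : A) (e : PrimeSpectrum A → ℕ) (he : StrictAnti e)
    (hrank : ∀ p : PrimeSpectrum A, t ∈ p.asIdeal → e p + 1 ≤ rankAtStalk P p)
    (x : P) (a : A) (ψ : P →ₗ[A] A) (b : A) (hψ : ψ x + b * a = 1) :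
    ∃ (q : P) (φ : P →ₗ[A] A) (c : A), φ (x + a • q) = 1 + t * c := by
  classical
  obtain ⟨n, g, hg⟩ := Module.Finite.exists_fin' A P
  obtain ⟨f, hgf⟩ := Module.projective_lifting_property g LinearMap.id hg
  have hg' : ∀ y, g (f y) = y := fun y => LinearMap.congr_fun hgf y
  obtain ⟨u, s, hs⟩ := Module.Finite.exists_fin (R := A) (M := P)
  obtain ⟨q, hq⟩ := exists_fiberMap_add_smul_ne_zero f t a e he u (Fin.cons x s) (by
    intro p htp _
    refine (min_le_right _ _).trans ((hrank p htp).trans ?_)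
    refine rankAtStalk_le_finrank_span_fiberMap f g hgf _ ?_ p
    rw [eq_top_iff, ← hs]
    refine Submodule.span_mono ?_
    rintro _ ⟨i, rfl⟩
    exact ⟨i.succ, by simp⟩)
  rw [Fin.cons_zero] at hq
  have htop : Ideal.span (insert t (Set.range (f (x + a • q)))) = ⊤ := by
    by_contra hne
    obtain ⟨m, hm, hle⟩ := Ideal.exists_le_maximal _ hne
    rw [Ideal.span_le, Set.insert_subset_iff] at hle
    obtain ⟨htm, hfm⟩ := hle
    let p : PrimeSpectrum A := ⟨m, hm.isPrime⟩
    by_cases ham : a ∈ m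
    · refine hm.ne_top ((Ideal.eq_top_iff_one _).mpr ?_)
      have hxm : ψ (x + a • q) ∈ m := by
        have : ψ (x + a • q) = ∑ j, f (x + a • q) j * ψ (g (Pi.single j 1)) := by
          conv_lhs => rw [← hg' (x + a • q), pi_eq_sum_univ' (f (x + a • q))]
          simp
        rw [this]
        exact Ideal.sum_mem _ fun j _ => Ideal.mul_mem_right _ _ (hfm ⟨j, rfl⟩)
      rw [map_add, map_smul, smul_eq_mul] at hxm
      have : (1 : A) = (ψ x + a * ψ q) + (b - ψ q) * a := by rw [← hψ]; ring
      rw [this]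
      exact Ideal.add_mem _ hxm (Ideal.mul_mem_left _ _ ham)
    · refine hq p htm ham (funext fun j => ?_)
      rw [fiberMap_apply]
      exact Ideal.algebraMap_residueField_eq_zero.mpr (hfm ⟨j, rfl⟩)
  have h1 : (1 : A) ∈ Ideal.span (insert t (Set.range (f (x + a • q)))) := htop ▸ Submodule.mem_top
  rw [Ideal.mem_span_insert] at h1
  obtain ⟨c, z, hz, hcz⟩ := h1
  obtain ⟨d, hd⟩ := (Submodule.mem_span_range_iff_exists_fun A).mp hz
  refine ⟨q, (Fintype.linearCombination A d) ∘ₗ f, -c, ?_⟩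
  have : Fintype.linearCombination A d (f (x + a • q)) = z := by
    rw [← hd, Fintype.linearCombination_apply]
    exact Finset.sum_congr rfl fun i _ => by simp [mul_comm]
  rw [LinearMap.comp_apply, this, hcz]
  ring

end BasicElements

section Cancellation

open Module

variable {A : Type*} [CommRing A] {P Q : Type*} [AddCommGroup P] [Module A P] [AddCommGroup Q]
  [Module A Q]

theorem LinearEquiv.fst_symm_fst_apply (F : (Q × A) ≃ₗ[A] (P × A)) (hF : F (0, 1) = (0, 1))
    (q : Q) : (F.symm ((F (q, 0)).1, 0)).1 = q := by
  have h : (((F (q, 0)).1, 0) : P × A) = F ((q, 0) - (F (q, 0)).2 • (0, 1)) := by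
    rw [map_sub, map_smul, hF]
    ext <;> simp
  rw [h, F.symm_apply_apply]
  simp

/-- An isomorphism `Q × A ≃ P × A` fixing `(0, 1)` induces an isomorphism `Q ≃ P`. -/
theorem nonempty_equiv_of_prod_equiv_apply_eq (F : (Q × A) ≃ₗ[A] (P × A))
    (hF : F (0, 1) = (0, 1)) : Nonempty (Q ≃ₗ[A] P) := by
  have hF' : F.symm (0, 1) = (0, 1) := by rw [← hF, F.symm_apply_apply]
  exact ⟨LinearEquiv.ofLinearMap
    (LinearMap.fst A P A ∘ₗ F.toLinearMap ∘ₗ LinearMap.inl A Q A)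
    (LinearMap.fst A Q A ∘ₗ F.symm.toLinearMap ∘ₗ LinearMap.inl A P A)
    (LinearMap.ext (LinearEquiv.fst_symm_fst_apply F.symm hF'))
    (LinearMap.ext (LinearEquiv.fst_symm_fst_apply F hF))⟩

/-- If the automorphisms of `P × A` act transitively on unimodular elements, then `P` is cancelled
from `P × A ≃ Q × A`. -/
theorem nonempty_equiv_of_prod_equiv
    (hP : ∀ (v : P × A) (ψ : P × A →ₗ[A] A), ψ v = 1 →
      ∃ T : (P × A) ≃ₗ[A] (P × A), T v = (0, 1))
    (F : (P × A) ≃ₗ[A] (Q × A)) : Nonempty (P ≃ₗ[A] Q) := by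
  obtain ⟨T, hT⟩ := hP (F.symm (0, 1)) (LinearMap.snd A Q A ∘ₗ F.toLinearMap) (by simp)
  obtain ⟨e⟩ := nonempty_equiv_of_prod_equiv_apply_eq (F.symm.trans T) hT
  exact ⟨e.symm⟩

/-- If `x + a q` is unimodular modulo `t`, then an automorphism of `P × A` takes `(x, a)` to an
element congruent to `(0, 1)` modulo `t`. -/
theorem exists_equiv_apply_eq_add_smul (t a c : A) (x q : P) (φ : P →ₗ[A] A)
    (h : φ (x + a • q) = 1 + t * c) :
    ∃ (T : (P × A) ≃ₗ[A] (P × A)) (y : P × A), T (x, a) = (0, 1) + t • y := by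
  have upper : ∀ q : P, ∃ T : (P × A) ≃ₗ[A] (P × A), ∀ x b, T (x, b) = (x + b • q, b) :=
    fun q => ⟨LinearEquiv.ofLinearMap
      ((LinearMap.fst A P A + (LinearMap.snd A P A).smulRight q).prod (LinearMap.snd A P A))
      ((LinearMap.fst A P A - (LinearMap.snd A P A).smulRight q).prod (LinearMap.snd A P A))
      (by ext <;> simp) (by ext <;> simp), fun x b => by simp⟩
  have lower : ∀ φ : P →ₗ[A] A, ∃ T : (P × A) ≃ₗ[A] (P × A), ∀ x b, T (x, b) = (x, b + φ x) :=
    fun φ => ⟨LinearEquiv.ofLinearMap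
      ((LinearMap.fst A P A).prod (LinearMap.snd A P A + φ ∘ₗ LinearMap.fst A P A))
      ((LinearMap.fst A P A).prod (LinearMap.snd A P A - φ ∘ₗ LinearMap.fst A P A))
      (by ext <;> simp) (by ext <;> simp), fun x b => by simp⟩
  obtain ⟨T₁, hT₁⟩ := upper q
  obtain ⟨T₂, hT₂⟩ := lower ((1 - a) • φ)
  obtain ⟨T₃, hT₃⟩ := upper (-(x + a • q))
  refine ⟨(T₁.trans T₂).trans T₃, (-((1 - a) * c) • (x + a • q), (1 - a) * c), ?_⟩
  have hb : a + (1 - a) * φ (x + a • q) = 1 + t * ((1 - a) * c) := by rw [h]; ring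
  simp only [LinearEquiv.trans_apply, hT₁, hT₂, hT₃, LinearMap.smul_apply, smul_eq_mul, hb]
  ext
  · simp only [Prod.fst_add, Prod.smul_fst]
    module
  · simp

/-- **Bass cancellation**. -/
theorem nonempty_equiv_of_prod_equiv_of_lt_rankAtStalk [IsNoetherianRing A] [Module.Finite A P]
    [Module.Projective A P] (e : PrimeSpectrum A → ℕ) (he : StrictAnti e)
    (hrank : ∀ p : PrimeSpectrum A, e p + 1 ≤ rankAtStalk P p)
    (F : (P × A) ≃ₗ[A] (Q × A)) : Nonempty (P ≃ₗ[A] Q) := by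
  refine nonempty_equiv_of_prod_equiv (fun v ψ hψ => ?_) F
  obtain ⟨x, a⟩ := v
  obtain ⟨q, φ, c, h⟩ := exists_add_smul_unimodular_mod 0 e he (fun p _ => hrank p) x a
    (ψ ∘ₗ LinearMap.inl A P A) (ψ (0, 1)) (by
      have : ((x, a) : P × A) = (x, 0) + a • (0, 1) := by simp
      rw [this, map_add, map_smul, smul_eq_mul] at hψ
      rw [mul_comm]
      exact hψ)
  obtain ⟨T, y, hT⟩ := exists_equiv_apply_eq_add_smul 0 a c x q φ h
  exact ⟨T, by simpa using hT⟩

theorem exists_equiv_apply_eq_of_isCancellative {S M : Type} [CommRing S] [AddCommGroup M]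
    [Module S M] [Module.Finite S M] [Module.Projective S M] (hM : IsCancellative S M)
    (v : M × S) (ψ : M × S →ₗ[S] S) (hψ : ψ v = 1) :
    ∃ T : (M × S) ≃ₗ[S] (M × S), T v = (0, 1) := by
  let π : M × S →ₗ[S] LinearMap.ker ψ :=
    (LinearMap.id - ψ.smulRight v).codRestrict (LinearMap.ker ψ) fun x => by simp [hψ]
  have hπ : ∀ x, (π x : M × S) = x - ψ x • v := fun x => rfl
  have hsplit : π ∘ₗ (LinearMap.ker ψ).subtype = LinearMap.id := by
    ext x : 2
    have hx : ψ (x : M × S) = 0 := x.2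
    simp only [LinearMap.comp_apply, hπ, Submodule.subtype_apply, hx, zero_smul, sub_zero,
      LinearMap.id_apply]
  have hfin : Module.Finite S (LinearMap.ker ψ) := Module.Finite.of_surjective π fun x =>
    ⟨x, LinearMap.congr_fun hsplit x⟩
  have hproj : Module.Projective S (LinearMap.ker ψ) := Module.Projective.of_split _ _ hsplit
  let G : (M × S) ≃ₗ[S] (LinearMap.ker ψ × S) := LinearEquiv.ofLinearMap (π.prod ψ)
    ((LinearMap.ker ψ).subtype.coprod (LinearMap.toSpanSingleton S _ v))
    (by
      refine LinearMap.ext fun ⟨x, b⟩ => ?_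
      have hx : ψ (x : M × S) = 0 := x.2
      refine Prod.ext (Subtype.ext ?_) ?_ <;> simp [hπ, hψ, hx])
    (by
      refine LinearMap.ext fun x => ?_
      simp [hπ])
  obtain ⟨f⟩ := hM (LinearMap.ker ψ) hfin hproj 1
    ⟨((LinearEquiv.refl S M).prodCongr (LinearEquiv.funUnique (Fin 1) S S)).trans
      (G.trans ((LinearEquiv.refl S _).prodCongr (LinearEquiv.funUnique (Fin 1) S S).symm))⟩
  refine ⟨G.trans (f.symm.prodCongr (LinearEquiv.refl S S)), ?_⟩
  have hG : G v = (0, 1) := Prod.ext (Subtype.ext (by simp [G, hπ, hψ])) hψ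
  rw [LinearEquiv.trans_apply, hG]
  simp

/-- The double of `A` along `s`: the pairs of elements of `A` congruent modulo `s`. -/
def doubleSubalgebra (A : Type*) [CommRing A] (s : A) : Subalgebra A (A × A) where
  carrier := {x | s ∣ x.1 - x.2}
  mul_mem' := by
    rintro ⟨x₁, x₂⟩ ⟨y₁, y₂⟩ ⟨c, hc⟩ ⟨d, hd⟩
    refine ⟨c * y₁ + x₂ * d, ?_⟩
    simp only [Prod.mk_mul_mk] at hc hd ⊢
    linear_combination y₁ * hc + x₂ * hd
  add_mem' := by
    rintro ⟨x₁, x₂⟩ ⟨y₁, y₂⟩ ⟨c, hc⟩ ⟨d, hd⟩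
    refine ⟨c + d, ?_⟩
    simp only [Prod.mk_add_mk] at hc hd ⊢
    linear_combination hc + hd
  algebraMap_mem' r := by simp

theorem mem_doubleSubalgebra {A : Type*} [CommRing A] {s : A} {x : A × A} :
    x ∈ doubleSubalgebra A s ↔ s ∣ x.1 - x.2 := Iff.rfl

/-- Unimodular rows congruent to the last basis vector modulo `s` are transformed into it by an
invertible matrix congruent to the identity modulo `s`, as soon as free modules over the double of
`A` along `s` are cancellative. -/
theorem exists_matrix_of_isCancellative_double {A : Type} [CommRing A] {d : ℕ} {s : A}
    (hs : s ∈ nonZeroDivisors A)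
    (hR : IsCancellative (doubleSubalgebra A s) (Fin d → doubleSubalgebra A s))
    (c u w : Fin d ⊕ Unit → A) (hu : u = Pi.single (Sum.inr ()) 1 + s • w)
    (hc : ∑ i, c i * u i = 1) :
    ∃ N N' : Matrix (Fin d ⊕ Unit) (Fin d ⊕ Unit) A,
      N + N' + s • (N * N') = 0 ∧ N' + N + s • (N' * N) = 0 ∧
      u + s • N.mulVec u = Pi.single (Sum.inr ()) 1 := by
  set R := doubleSubalgebra A s
  set ε : Fin d ⊕ Unit → A := Pi.single (Sum.inr ()) 1 with hε
  let V : Fin d ⊕ Unit → R := fun i => ⟨(u i, ε i), w i, by simp [hu]⟩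
  have hcε : c (Sum.inr ()) = 1 - s * ∑ i, c i * w i := by
    rw [← hc, hu, Finset.mul_sum, ← Finset.sum_sub_distrib]
    rw [Finset.sum_congr rfl (g := fun i => c i * ε i) fun i _ => by
      simp only [Pi.add_apply, Pi.smul_apply, smul_eq_mul]; ring]
    simp [hε]
  let C : Fin d ⊕ Unit → R := Sum.elim
    (fun i => ⟨(c (Sum.inl i), c (Sum.inl i)), by simp [R, mem_doubleSubalgebra]⟩)
    (fun _ => ⟨(c (Sum.inr ()), 1), -∑ i, c i * w i, by rw [hcε]; ring⟩)
  have hCV : ∑ i, C i * V i = 1 := by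
    apply Subtype.ext
    simp only [AddSubmonoidClass.coe_finsetSum, MulMemClass.coe_mul, OneMemClass.coe_one]
    refine Prod.ext ?_ ?_
    · rw [Prod.fst_sum, Prod.fst_one, ← hc]
      refine Finset.sum_congr rfl fun i _ => ?_
      rcases i with i | i <;> rfl
    · rw [Prod.snd_sum, Prod.snd_one]
      simp [C, V, hε]
  let E : (Fin d ⊕ Unit → R) ≃ₗ[R] (Fin d → R) × R :=
    (LinearEquiv.sumArrowLequivProdArrow (Fin d) Unit R R).trans
      ((LinearEquiv.refl R _).prodCongr (LinearEquiv.funUnique Unit R R))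
  have hE : E (Pi.single (Sum.inr ()) 1) = (0, 1) := by
    refine Prod.ext (funext fun i => ?_) ?_ <;> simp [E]
  obtain ⟨T, hT⟩ := exists_equiv_apply_eq_of_isCancellative hR (E V)
    (Fintype.linearCombination R C ∘ₗ E.symm.toLinearMap) (by
      rw [LinearMap.comp_apply, LinearEquiv.coe_coe, E.symm_apply_apply,
        Fintype.linearCombination_apply, ← hCV]
      exact Finset.sum_congr rfl fun i _ => by rw [smul_eq_mul, mul_comm])
  let Γ := (E.trans T).trans E.symm
  have hΓ : Γ V = Pi.single (Sum.inr ()) 1 := by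
    simp [Γ, hT, ← hE]
  let M := LinearMap.toMatrix' Γ.toLinearMap
  let M' := LinearMap.toMatrix' Γ.symm.toLinearMap
  have hMM' : M * M' = 1 := by
    rw [← LinearMap.toMatrix'_comp]; simp
  have hM'M : M' * M = 1 := by
    rw [← LinearMap.toMatrix'_comp]; simp
  have hMV : M.mulVec V = Pi.single (Sum.inr ()) 1 := by
    rw [LinearMap.toMatrix'_mulVec]; exact hΓ
  let π₁ : R →+* A := (RingHom.fst A A).comp R.val.toRingHom
  let π₂ : R →+* A := (RingHom.snd A A).comp R.val.toRingHom
  have hcong : ∀ x : R, ∃ y, π₁ x = π₂ x + s * y := fun x => by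
    obtain ⟨y, hy⟩ := x.2
    exact ⟨y, by rw [← hy]; simp [π₁, π₂]⟩
  have hdiff : ∀ X : Matrix (Fin d ⊕ Unit) (Fin d ⊕ Unit) R, ∃ D : Matrix _ _ A,
      X.map π₁ = X.map π₂ + s • D := by
    intro X
    choose D hD using fun i j => hcong (X i j)
    exact ⟨Matrix.of D, by ext i j; simp [hD]⟩
  have hmul : ∀ (π : R →+* A) (X Y : Matrix (Fin d ⊕ Unit) (Fin d ⊕ Unit) R), X * Y = 1 →
      X.map π * Y.map π = 1 := by
    intro π X Y h
    rw [← Matrix.map_mul, h, Matrix.map_one _ (map_zero π) (map_one π)]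
  have hvec : ∀ (π : R →+* A), (M.map π).mulVec (π ∘ V) = ε := by
    intro π
    funext i
    rw [← RingHom.map_mulVec, hMV, hε, Pi.single_apply, Pi.single_apply]
    split_ifs <;> simp
  have hu₁ : (M.map π₁).mulVec u = ε := hvec π₁
  have hu₂ : (M.map π₂).mulVec ε = ε := hvec π₂
  have hu₂' : (M'.map π₂).mulVec ε = ε := by
    conv_lhs => rw [← hu₂, Matrix.mulVec_mulVec, hmul π₂ _ _ hM'M, Matrix.one_mulVec]
  obtain ⟨D, hD⟩ := hdiff M
  obtain ⟨D', hD'⟩ := hdiff M'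
  set M₁ := M.map π₁
  set M₂ := M.map π₂
  set M₁' := M'.map π₁
  set M₂' := M'.map π₂
  have hg : M₂' * M₁ = 1 + s • (M₂' * D) := by
    rw [hD, Matrix.mul_add, hmul π₂ _ _ hM'M, Matrix.mul_smul]
  have hg' : M₁' * M₂ = 1 + s • (D' * M₂) := by
    rw [hD', Matrix.add_mul, hmul π₂ _ _ hM'M, Matrix.smul_mul]
  have hgg' : (M₂' * M₁) * (M₁' * M₂) = 1 := by
    rw [Matrix.mul_assoc, ← Matrix.mul_assoc M₁, hmul π₁ _ _ hMM', Matrix.one_mul,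
      hmul π₂ _ _ hM'M]
  have hg'g : (M₁' * M₂) * (M₂' * M₁) = 1 := mul_eq_one_comm.mp hgg'
  have cancel : ∀ X Y : Matrix (Fin d ⊕ Unit) (Fin d ⊕ Unit) A,
      (1 + s • X) * (1 + s • Y) = 1 → X + Y + s • (X * Y) = 0 := by
    intro X Y h
    have h1 : s • (X + Y + s • (X * Y)) = 0 := by
      rw [← sub_eq_zero.mpr h]
      simp only [add_mul, mul_add, one_mul, mul_one, Matrix.smul_mul, Matrix.mul_smul, smul_add]
      abel
    ext i j
    have h2 := congrFun (congrFun h1 i) j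
    rw [Matrix.smul_apply, smul_eq_mul, Matrix.zero_apply] at h2
    exact (mem_nonZeroDivisors_iff.mp hs).1 _ h2
  rw [hg, hg'] at hgg' hg'g
  refine ⟨M₂' * D, D' * M₂, cancel _ _ hgg', cancel _ _ hg'g, ?_⟩
  have : (M₂' * M₁).mulVec u = ε := by rw [← Matrix.mulVec_mulVec, hu₁, hu₂']
  rw [hg, Matrix.add_mulVec, Matrix.one_mulVec, Matrix.smul_mulVec] at this
  exact this

end Cancellation

section Descent

open Module TensorProduct

variable {A : Type*} [CommRing A] {P : Type*} [AddCommGroup P] [Module A P]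

/-- A projective module of constant rank `d` over a Noetherian ring is isomorphic to `Aᵈ` up to a
nonzerodivisor. -/
theorem exists_comp_eq_smul_of_rankAtStalk_eq [IsNoetherianRing A] [Module.Finite A P]
    [Module.Projective A P] {d : ℕ} (hrank : ∀ p : PrimeSpectrum A, rankAtStalk P p = d) :
    ∃ s ∈ nonZeroDivisors A, ∃ (j : (Fin d → A) →ₗ[A] P) (h : P →ₗ[A] (Fin d → A)),
      (∀ x, j (h x) = s • x) ∧ ∀ y, h (j y) = s • y := by
  let K := FractionRing A
  have hfinrank : ∀ m : MaximalSpectrum K, finrank (K ⧸ m.1) ((K ⧸ m.1) ⊗[K] (K ⊗[A] P)) = d := by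
    intro m
    have := m.2
    let := Ideal.Quotient.field m.1
    have h := rankAtStalk_eq_finrank_of_free (R := K ⧸ m.1)
      (M := (K ⧸ m.1) ⊗[K] (K ⊗[A] P))
    have h0 := congrFun h (⊥ : PrimeSpectrum (K ⧸ m.1))
    rw [rankAtStalk_baseChange, rankAtStalk_baseChange, hrank] at h0
    simpa using h0.symm
  obtain ⟨b⟩ := nonempty_basis_of_flat_of_finrank_eq K (K ⊗[A] P) d hfinrank
  let ι : (Fin d → A) →ₗ[A] (Fin d → K) :=
    LinearMap.pi fun i => Algebra.linearMap A K ∘ₗ LinearMap.proj i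
  have hι : Function.Injective ι := fun x y hxy =>
    funext fun i => IsFractionRing.injective A K (congrFun hxy i)
  let μ : P →ₗ[A] K ⊗[A] P := TensorProduct.mk A K P 1
  have hμ : Function.Injective μ := by
    have := (Flat.rTensor_preserves_injective_linearMap (M := P) (Algebra.linearMap A K)
      (IsFractionRing.injective A K)).comp (TensorProduct.lid A P).symm.injective
    convert this using 1
    ext x
    simp [μ]
  have : Module.FinitePresentation A P := Module.finitePresentation_of_finite A P
  let β : K ⊗[A] P ≃ₗ[A] (Fin d → K) := b.equivFun.restrictScalars A
  obtain ⟨h, s₁, hs₁⟩ := FinitePresentation.exists_lift_of_isLocalizedModule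
    (nonZeroDivisors A) ι (β.toLinearMap ∘ₗ μ)
  obtain ⟨j, s₂, hs₂⟩ := FinitePresentation.exists_lift_of_isLocalizedModule
    (nonZeroDivisors A) μ (β.symm.toLinearMap ∘ₗ ι)
  have hh : ∀ x, ι (h x) = (s₁ : A) • β (μ x) := fun x => LinearMap.congr_fun hs₁ x
  have hj : ∀ y, μ (j y) = (s₂ : A) • β.symm (ι y) := fun y => LinearMap.congr_fun hs₂ y
  refine ⟨s₁ * s₂, mul_mem s₁.2 s₂.2, j, h, fun x => hμ ?_, fun y => hι ?_⟩
  · rw [hj, hh, map_smul, β.symm_apply_apply, map_smul, smul_smul, mul_comm]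
  · rw [hh, hj, map_smul, β.apply_symm_apply, map_smul, smul_smul]

/-- Mutually inverse perturbations `1 + J N H` and `1 + J N' H` of the identity. -/
theorem exists_equiv_apply_eq_add_comp {V W : Type*} [AddCommGroup V] [Module A V]
    [AddCommGroup W] [Module A W] (s : A) (J : V →ₗ[A] W) (H : W →ₗ[A] V)
    (hHJ : ∀ y, H (J y) = s • y) (N N' : V →ₗ[A] V)
    (h₁ : ∀ y, N y + N' y + s • N (N' y) = 0) (h₂ : ∀ y, N' y + N y + s • N' (N y) = 0) :
    ∃ T : W ≃ₗ[A] W, ∀ x, T x = x + J (N (H x)) := by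
  have key : ∀ N N' : V →ₗ[A] V, (∀ y, N y + N' y + s • N (N' y) = 0) →
      (LinearMap.id + J ∘ₗ N ∘ₗ H) ∘ₗ (LinearMap.id + J ∘ₗ N' ∘ₗ H) = LinearMap.id := by
    intro N N' h
    refine LinearMap.ext fun x => ?_
    have hJ := congrArg J (h (H x))
    simp only [map_add, map_smul, map_zero] at hJ
    simp only [LinearMap.comp_apply, LinearMap.add_apply, LinearMap.id_apply, map_add, hHJ,
      map_smul]
    refine Eq.trans ?_ (add_zero x)
    rw [← hJ]
    abel
  exact ⟨LinearEquiv.ofLinearMap _ _ (key N N' h₁) (key N' N h₂), fun x => rfl⟩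

/-- If the free module of rank `d` over the double of `A` along `s` is cancellative and `P` is
isomorphic to `Aᵈ` up to `s`, then automorphisms of `P × A` take unimodular elements congruent to
`(0, 1)` modulo `s ^ 2` to `(0, 1)`. -/
theorem exists_equiv_apply_eq_of_isCancellative_double {A : Type} [CommRing A] {P : Type*}
    [AddCommGroup P] [Module A P] {d : ℕ} {s : A} (hs : s ∈ nonZeroDivisors A)
    (hR : IsCancellative (doubleSubalgebra A s) (Fin d → doubleSubalgebra A s))
    (j : (Fin d → A) →ₗ[A] P) (h : P →ₗ[A] (Fin d → A)) (hjh : ∀ x, j (h x) = s • x)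
    (hhj : ∀ y, h (j y) = s • y) (y : P × A) (ψ : P × A →ₗ[A] A)
    (hψ : ψ ((0, 1) + s ^ 2 • y) = 1) :
    ∃ T : (P × A) ≃ₗ[A] (P × A), T ((0, 1) + s ^ 2 • y) = (0, 1) := by
  let E : (Fin d ⊕ Unit → A) ≃ₗ[A] (Fin d → A) × A :=
    (LinearEquiv.sumArrowLequivProdArrow (Fin d) Unit A A).trans
      ((LinearEquiv.refl A _).prodCongr (LinearEquiv.funUnique Unit A A))
  have hE : E (Pi.single (Sum.inr ()) 1) = (0, 1) := by
    refine Prod.ext (funext fun i => ?_) ?_ <;> simp [E]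
  let J : (Fin d ⊕ Unit → A) →ₗ[A] P × A := j.prodMap LinearMap.id ∘ₗ E.toLinearMap
  let H : P × A →ₗ[A] (Fin d ⊕ Unit → A) :=
    E.symm.toLinearMap ∘ₗ h.prodMap (s • LinearMap.id)
  have hJε : J (Pi.single (Sum.inr ()) 1) = (0, 1) := by simp [J, hE]
  have hJH : ∀ x, J (H x) = s • x := fun x => by
    simp only [J, H, LinearMap.comp_apply, LinearEquiv.coe_coe, E.apply_symm_apply]
    exact Prod.ext (hjh x.1) rfl
  have hHJ : ∀ x, H (J x) = s • x := fun x => by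
    have : h.prodMap (s • LinearMap.id) (j.prodMap LinearMap.id (E x)) = s • E x :=
      Prod.ext (hhj _) rfl
    simp only [J, H, LinearMap.comp_apply, LinearEquiv.coe_coe, this, map_smul,
      E.symm_apply_apply]
  set u : Fin d ⊕ Unit → A := Pi.single (Sum.inr ()) 1 + s • H y with hu
  have hJu : J u = (0, 1) + s ^ 2 • y := by
    rw [hu, map_add, map_smul, hJε, hJH, smul_smul, sq]
  obtain ⟨N, N', h₁, h₂, hN⟩ := exists_matrix_of_isCancellative_double hs hR
    (fun i => ψ (J (Pi.single i 1))) u (H y) hu (by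
      rw [← hJu] at hψ
      refine Eq.trans ?_ hψ
      conv_rhs => rw [pi_eq_sum_univ' u]
      rw [map_sum, map_sum]
      exact Finset.sum_congr rfl fun i _ => by rw [map_smul, map_smul, smul_eq_mul, mul_comm])
  obtain ⟨T, hT⟩ := exists_equiv_apply_eq_add_comp s J H hHJ N.mulVecLin N'.mulVecLin
    (fun x => by
      simpa [Matrix.add_mulVec, Matrix.smul_mulVec] using congrArg (fun X => X.mulVec x) h₁)
    (fun x => by
      simpa [Matrix.add_mulVec, Matrix.smul_mulVec] using congrArg (fun X => X.mulVec x) h₂)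
  refine ⟨T, ?_⟩
  rw [hT, ← hJu, hHJ, ← map_add, map_smul, Matrix.mulVecLin_apply, hN, hJε]

theorem strictAnti_toNat_coheight {d : ℕ} (hdim : ringKrullDim A = d) :
    StrictAnti fun p : PrimeSpectrum A => (Order.coheight p).toNat := by
  intro p q hpq
  have hfin : ∀ p : PrimeSpectrum A, Order.coheight p ≠ ⊤ := by
    intro p h
    have := Order.coheight_le_krullDim p
    rw [← ringKrullDim, hdim, h] at this
    exact absurd (WithBot.coe_le_coe.mp this) (by simp)
  have := Order.coheight_strictAnti hpq (lt_top_iff_ne_top.mpr (hfin q))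
  rwa [← ENat.natCast_toNat (hfin p), ← ENat.natCast_toNat (hfin q), Nat.cast_lt] at this

theorem toNat_coheight_le {d : ℕ} (hdim : ringKrullDim A = d) (p : PrimeSpectrum A) :
    (Order.coheight p).toNat ≤ d := by
  have := Order.coheight_le_krullDim p
  rw [← ringKrullDim, hdim] at this
  exact ENat.toNat_le_of_le_natCast (WithBot.coe_le_coe.mp this)

theorem toNat_coheight_lt_of_mem {d : ℕ} (hdim : ringKrullDim A = d) {s : A}
    (hs : s ∈ nonZeroDivisors A) {p : PrimeSpectrum A} (hp : s ∈ p.asIdeal) :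
    (Order.coheight p).toNat < d := by
  obtain ⟨q, hq, hqp⟩ := Ideal.exists_minimalPrimes_le (I := ⊥) (J := p.asIdeal) bot_le
  let Q : PrimeSpectrum A := ⟨q, hq.1.1⟩
  have hlt : Q < p := lt_of_le_of_ne hqp fun h =>
    Set.disjoint_left.mp (Ideal.disjoint_nonZeroDivisors_of_mem_minimalPrimes hq)
      (show s ∈ Q.asIdeal from h ▸ hp) hs
  exact (strictAnti_toNat_coheight hdim hlt).trans_le (toNat_coheight_le hdim Q)

end Descent

theorem statement2
    (A : Type) [CommRing A] [IsNoetherianRing A] (d : ℕ) (hdim : ringKrullDim A = d)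
    -- for every finite ring extension `R` of `A`, `R ^ d` is cancellative
    (hext : ∀ (R : Type) [CommRing R] [Algebra A R],
      Function.Injective (algebraMap A R) → Module.Finite A R →
        IsCancellative R (Fin d → R))
    (P : Type) [AddCommGroup P] [Module A P] [Module.Finite A P] [Module.Projective A P]
    (hrank : HasRank A P d) :
    IsCancellative A P := by
  have he := strictAnti_toNat_coheight hdim
  intro Q _ _ _ _ m
  induction m with
  | zero =>
    rintro ⟨F⟩
    exact ⟨(LinearEquiv.prodUnique.symm.trans F).trans LinearEquiv.prodUnique⟩
  | succ m ih =>
    rintro ⟨F⟩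
    let e : ∀ (M : Type) [AddCommGroup M] [Module A M],
        (M × (Fin (m + 1) → A)) ≃ₗ[A] (M × (Fin m → A)) × A := fun M _ _ =>
      ((LinearEquiv.refl A M).prodCongr ((Fin.consLinearEquiv A fun _ => A).symm.trans
        (LinearEquiv.prodComm A _ _))).trans (LinearEquiv.prodAssoc A M (Fin m → A) A).symm
    let G := ((e P).symm.trans F).trans (e Q)
    rcases Nat.eq_zero_or_pos m with rfl | hm
    · let G' := ((LinearEquiv.prodUnique.symm.prodCongr (LinearEquiv.refl A A)).trans G).trans
        (LinearEquiv.prodUnique.prodCongr (LinearEquiv.refl A A))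
      refine nonempty_equiv_of_prod_equiv (fun v ψ hψ => ?_) G'
      obtain ⟨x, a⟩ := v
      obtain ⟨s, hs, j, h, hjh, hhj⟩ := exists_comp_eq_smul_of_rankAtStalk_eq hrank
      obtain ⟨q, φ, c, hφ⟩ := exists_add_smul_unimodular_mod (s ^ 2) _ he (fun p hp => by
        rw [hrank p]
        exact toNat_coheight_lt_of_mem hdim hs (p.isPrime.mem_of_pow_mem 2 hp)) x a
        (ψ ∘ₗ LinearMap.inl A P A) (ψ (0, 1)) (by
          refine Eq.trans ?_ hψ
          rw [LinearMap.comp_apply, LinearMap.inl_apply, mul_comm, ← smul_eq_mul, ← map_smul,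
            ← map_add]
          simp)
      obtain ⟨T₁, y, hT₁⟩ := exists_equiv_apply_eq_add_smul (s ^ 2) a c x q φ hφ
      have hR := hext (doubleSubalgebra A s)
        (fun b b' hb => congrArg (fun r : doubleSubalgebra A s => (r : A × A).1) hb)
        (Module.IsNoetherian.finite A (Subalgebra.toSubmodule (doubleSubalgebra A s)))
      obtain ⟨T₂, hT₂⟩ := exists_equiv_apply_eq_of_isCancellative_double hs hR j h hjh hhj y
        (ψ ∘ₗ T₁.symm.toLinearMap) (by
          rw [← hT₁, LinearMap.comp_apply, LinearEquiv.coe_coe, T₁.symm_apply_apply, hψ])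
      exact ⟨T₁.trans T₂, by rw [LinearEquiv.trans_apply, hT₁, hT₂]⟩
    · refine ih (nonempty_equiv_of_prod_equiv_of_lt_rankAtStalk _ he (fun p => ?_) G)
      have : Nontrivial A := p.nontrivial
      rw [Module.rankAtStalk_prod, Pi.add_apply, hrank p, Module.rankAtStalk_eq_finrank_of_free]
      have := toNat_coheight_le hdim p
      simp
      omega
end
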